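/- Let Σ be a finite alphabet and L ⊆ Σ* a language. The following are equivalent: (1) L is star-free; (2) L is recognized by some planar deterministic two-way finite automaton; (3) L is recognized by some planar reversible two-way finite automaton. -/

import Mathlib

namespace Planar2DFT

/-- Tape alphabet: input letters plus the two endmarkers `▷` and `◁`. -/
inductive Tape (A : Type) where
  | lend : Tape A
  | rend : Tape A
  | sym  : A → Tape A

/-- Edges of the transition profile `G(ρ, f)` on vertices `Q × Bool`
(`true` codes direction `+1`, `false` codes `-1`): an edge
`(q, -ρ q) → (r, ρ r)` for every `(q, r) ∈ f`. -/
def ProfileEdge {Q : Type} (ρ : Q → Bool) (f : Set (Q × Q)) :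
    Q × Bool → Q × Bool → Prop :=
  fun u v => ∃ p ∈ f, u = (p.1, !ρ p.1) ∧ v = (p.2, ρ p.2)

/-- The extension of a strict order on `Q` to `Q × Bool`:
`(q,i) < (r,j)` iff (`i = -1` and `j = 1`), or (`q < r` and `i = j = 1`),
or (`q > r` and `i = j = -1`). -/
def ExtLt {Q : Type} (lt : Q → Q → Prop) : Q × Bool → Q × Bool → Prop :=
  fun x y =>
    (x.2 = false ∧ y.2 = true) ∨
    (lt x.1 y.1 ∧ x.2 = true ∧ y.2 = true) ∨
    (lt y.1 x.1 ∧ x.2 = false ∧ y.2 = false)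

/-- Planarity of a transition w.r.t. a direction map `ρ` and a strict total
order `lt`: no vertices `u < r < v < s` with an edge between `u` and `v`
(in either direction) and an edge between `r` and `s` (in either direction). -/
def IsPlanar {Q : Type} (ρ : Q → Bool) (lt : Q → Q → Prop) (f : Set (Q × Q)) : Prop :=
  ¬ ∃ u r v s : Q × Bool, ExtLt lt u r ∧ ExtLt lt r v ∧ ExtLt lt v s ∧
      (ProfileEdge ρ f u v ∨ ProfileEdge ρ f v u) ∧
      (ProfileEdge ρ f r s ∨ ProfileEdge ρ f s r)

/-- Deterministic transition: a partial function. -/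
def IsDet {Q : Type} (f : Set (Q × Q)) : Prop :=
  ∀ q r r', (q, r) ∈ f → (q, r') ∈ f → r = r'

/-- Reversible transition: a partial injection. -/
def IsRev {Q : Type} (f : Set (Q × Q)) : Prop :=
  IsDet f ∧ ∀ q q' r, (q, r) ∈ f → (q', r) ∈ f → q = q'

/-- Edges of the glued graph `C(ρ, f, g)` on `Q × Fin 3`, levels `0, 1, 2`
coding `-1, 0, 1`: the copy of `G(ρ,f)` lives on levels `{0,1}` (side `+1`
corresponding to level `1`) and the copy of `G(ρ,g)` on levels `{1,2}`
(side `+1` corresponding to level `2`). -/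
def GlueEdge {Q : Type} (ρ : Q → Bool) (f g : Set (Q × Q)) :
    Q × Fin 3 → Q × Fin 3 → Prop :=
  fun x y =>
    (x.2 ≠ 2 ∧ y.2 ≠ 2 ∧
      ProfileEdge ρ f (x.1, decide (x.2 = 1)) (y.1, decide (y.2 = 1))) ∨
    (x.2 ≠ 0 ∧ y.2 ≠ 0 ∧
      ProfileEdge ρ g (x.1, decide (x.2 = 2)) (y.1, decide (y.2 = 2)))

/-- Gluing composition `f * g` of transitions: `(q, r) ∈ f * g` iff there is a
directed path from `(q, -ρ q)` to `(r, ρ r)` in the glued graph `C(ρ, f, g)`. -/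
def glue {Q : Type} (ρ : Q → Bool) (f g : Set (Q × Q)) : Set (Q × Q) :=
  {p | Relation.ReflTransGen (GlueEdge ρ f g)
        (p.1, if ρ p.1 then (0 : Fin 3) else 2)
        (p.2, if ρ p.2 then (2 : Fin 3) else 0)}

/-- The identity transition, unit of the gluing composition. -/
def idRel (Q : Type) : Set (Q × Q) := {p | p.1 = p.2}

/-- Iterated gluing powers of a transition, with `glpow ρ f 0 = idRel Q`. -/
def glpow {Q : Type} (ρ : Q → Bool) (f : Set (Q × Q)) : ℕ → Set (Q × Q)
  | 0 => idRel Q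
  | n + 1 => glue ρ (glpow ρ f n) f

/-- A configuration of a two-way machine: the tape content to the left of the
head, the current state, and the tape content to the right of the head. -/
abbrev Config (Q A : Type) := List (Tape A) × Q × List (Tape A)

/-- The tape encoding `▷ u ◁` of an input word `u`. -/
def tapeOf {A : Type} (u : List A) : List (Tape A) :=
  Tape.lend :: (u.map Tape.sym ++ [Tape.rend])

/-- A two-way (nondeterministic) finite transducer. -/
structure TwoWayTransducer (Q A B : Type) where
  ρ : Q → Bool
  init : Q
  init_fwd : ρ init = true
  final : Set Q
  δ : Tape A → Set (Q × List B × Q)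

namespace TwoWayTransducer

variable {Q A B : Type}

/-- The transitions `⌊δ⌋(a)` of the underlying automaton. -/
def rel (T : TwoWayTransducer Q A B) (a : Tape A) : Set (Q × Q) :=
  {p | ∃ w, (p.1, w, p.2) ∈ T.δ a}

def Deterministic (T : TwoWayTransducer Q A B) : Prop :=
  ∀ a, IsDet (T.rel a)

def Reversible (T : TwoWayTransducer Q A B) : Prop :=
  ∀ a, IsRev (T.rel a)

def Planar (T : TwoWayTransducer Q A B) : Prop :=
  ∃ lt : Q → Q → Prop, IsStrictTotalOrder Q lt ∧
    ∀ a : A, IsPlanar T.ρ lt (T.rel (Tape.sym a))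

/-- One step of the two-way transducer, labelled by the output word. -/
def Step (T : TwoWayTransducer Q A B) (c : Config Q A) (w : List B)
    (c' : Config Q A) : Prop :=
  ∃ a u v q r, (q, w, r) ∈ T.δ a ∧
    ((T.ρ q = true ∧ T.ρ r = true ∧ c = (u, q, a :: v) ∧ c' = (u ++ [a], r, v)) ∨
     (T.ρ q = true ∧ T.ρ r = false ∧ c = (u, q, a :: v) ∧ c' = (u, r, a :: v)) ∨
     (T.ρ q = false ∧ T.ρ r = false ∧ c = (u ++ [a], q, v) ∧ c' = (u, r, a :: v)) ∨
     (T.ρ q = false ∧ T.ρ r = true ∧ c = (u ++ [a], q, v) ∧ c' = (u ++ [a], r, v)))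

/-- Multi-step runs, accumulating the concatenated output. -/
inductive Run (T : TwoWayTransducer Q A B) : Config Q A → List B → Config Q A → Prop
  | refl (c : Config Q A) : Run T c [] c
  | step {c₁ w₁ c₂ w₂ c₃} : Run T c₁ w₁ c₂ → T.Step c₂ w₂ c₃ → Run T c₁ (w₁ ++ w₂) c₃

/-- The pair `(u, v)` is realized by `T`. -/
def Realizes (T : TwoWayTransducer Q A B) (u : List A) (v : List B) : Prop :=
  ∃ qf ∈ T.final, T.Run ([], T.init, tapeOf u) v (tapeOf u, qf, [])

/-- `T` computes the partial function `f`. -/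
def Computes (T : TwoWayTransducer Q A B) (f : List A → Option (List B)) : Prop :=
  ∀ u v, f u = some v ↔ T.Realizes u v

end TwoWayTransducer

/-- Membership in the least submonoid of `B(Q,ρ)` containing the transitions
`⌊δ⌋(a)` for the input letters `a`. -/
inductive InBehav {Q A B : Type} (T : TwoWayTransducer Q A B) : Set (Q × Q) → Prop
  | one : InBehav T (idRel Q)
  | gen (a : A) : InBehav T (T.rel (Tape.sym a))
  | mul {f g} : InBehav T f → InBehav T g → InBehav T (glue T.ρ f g)

/-- The behaviour monoid `B(T)` is aperiodic. -/
def ApBehav {Q A B : Type} (T : TwoWayTransducer Q A B) : Prop :=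
  ∃ n : ℕ, ∀ f, InBehav T f → glpow T.ρ f (n + 1) = glpow T.ρ f n

/-- A first-order transduction: a partial function computed by some
deterministic two-way transducer whose behaviour monoid is aperiodic. -/
def IsFOTransduction {A B : Type} (f : List A → Option (List B)) : Prop :=
  ∃ (n : ℕ) (T : TwoWayTransducer (Fin n) A B),
    T.Deterministic ∧ ApBehav T ∧ T.Computes f

/-- A two-way (nondeterministic) finite automaton. -/
structure TwoWayAutomaton (Q A : Type) where
  ρ : Q → Bool
  init : Q
  init_fwd : ρ init = true
  final : Set Q
  δ : Tape A → Set (Q × Q)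

namespace TwoWayAutomaton

variable {Q A : Type}

def Deterministic (M : TwoWayAutomaton Q A) : Prop := ∀ a, IsDet (M.δ a)

def Reversible (M : TwoWayAutomaton Q A) : Prop := ∀ a, IsRev (M.δ a)

def Planar (M : TwoWayAutomaton Q A) : Prop :=
  ∃ lt : Q → Q → Prop, IsStrictTotalOrder Q lt ∧
    ∀ a : A, IsPlanar M.ρ lt (M.δ (Tape.sym a))

/-- One step of the two-way automaton. -/
def Step (M : TwoWayAutomaton Q A) (c c' : Config Q A) : Prop :=
  ∃ a u v q r, (q, r) ∈ M.δ a ∧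
    ((M.ρ q = true ∧ M.ρ r = true ∧ c = (u, q, a :: v) ∧ c' = (u ++ [a], r, v)) ∨
     (M.ρ q = true ∧ M.ρ r = false ∧ c = (u, q, a :: v) ∧ c' = (u, r, a :: v)) ∨
     (M.ρ q = false ∧ M.ρ r = false ∧ c = (u ++ [a], q, v) ∧ c' = (u, r, a :: v)) ∨
     (M.ρ q = false ∧ M.ρ r = true ∧ c = (u ++ [a], q, v) ∧ c' = (u ++ [a], r, v)))

def Accepts (M : TwoWayAutomaton Q A) (u : List A) : Prop :=
  ∃ qf ∈ M.final, Relation.ReflTransGen M.Step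
    ([], M.init, tapeOf u) (tapeOf u, qf, [])

def Language (M : TwoWayAutomaton Q A) : Set (List A) := {u | M.Accepts u}

end TwoWayAutomaton

/-- The underlying automaton `⌊T⌋` of a transducer `T`. -/
def forget {Q A B : Type} (T : TwoWayTransducer Q A B) : TwoWayAutomaton Q A :=
  { ρ := T.ρ, init := T.init, init_fwd := T.init_fwd, final := T.final,
    δ := fun a => T.rel a }

/-- Star-free languages: the smallest class containing all finite languages
and closed under finite union, complement and concatenation. -/
inductive StarFree {A : Type} : Set (List A) → Prop
  | of_finite (L : Set (List A)) : L.Finite → StarFree L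
  | union {L M : Set (List A)} : StarFree L → StarFree M → StarFree (L ∪ M)
  | compl {L : Set (List A)} : StarFree L → StarFree Lᶜ
  | concat {L M : Set (List A)} : StarFree L → StarFree M →
      StarFree {w | ∃ u ∈ L, ∃ v ∈ M, w = u ++ v}

/-- A (total, deterministic) sequential transducer. -/
structure SeqTransducer (Q A B : Type) where
  init : Q
  next : A → Q → Q
  out : A → Q → List B
  fin : Q → List B

namespace SeqTransducer

variable {Q A B : Type}

/-- Running a sequential transducer on a word from a state: final state and
produced output. -/
def run (T : SeqTransducer Q A B) : List A → Q → Q × List B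
  | [], q => (q, [])
  | a :: w, q =>
      let p := run T w (T.next a q)
      (p.1, T.out a q ++ p.2)

/-- The (total) sequential function computed by a sequential transducer. -/
def fn (T : SeqTransducer Q A B) (w : List A) : List B :=
  (T.run w T.init).2 ++ T.fin (T.run w T.init).1

end SeqTransducer

/-- Membership in the transition monoid of a sequential transducer, i.e. the
monoid of functions `Q → Q` generated by the `∂₁(a)`. -/
inductive SeqGen {Q A B : Type} (T : SeqTransducer Q A B) : (Q → Q) → Prop
  | id : SeqGen T id
  | gen (a : A) : SeqGen T (T.next a)
  | comp {h h'} : SeqGen T h → SeqGen T h' → SeqGen T (h ∘ h')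

/-- A sequential transducer is aperiodic when its transition monoid is. -/
def SeqTransducer.Aperiodic {Q A B : Type} (T : SeqTransducer Q A B) : Prop :=
  ∃ n : ℕ, ∀ h, SeqGen T h → h^[n + 1] = h^[n]


/-- Letter-to-letter sequential map. -/
def smap {A B S : Type} (nx : S → A → S) (o : S → A → B) : S → List A → List B
  | _, [] => []
  | s, a :: w => o s a :: smap nx o (nx s a) w

/-- Closure conditions on a class of languages. -/
structure LangClass (P : ∀ A : Type, Set (List A) → Prop) : Prop where
  ff : ∀ (A B V : Type) [Finite A] [Finite B] [Finite V] (u : A → Option V) (o : V → A → B) (v : V)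
    (L : Set (List B)), P B L → P A {w | smap (fun v a => (u a).getD v) o v w ∈ L}
  last : ∀ (A : Type) [Finite A] (R : Option A → Prop), P A {w | R w.getLast?}

/-- A semiautomaton along which the class can be pulled back. -/
def Good (P : ∀ A : Type, Set (List A) → Prop) {A S : Type} (nx : S → A → S) (s : S) : Prop :=
  ∀ (B : Type) [Finite B] (o : S → A → B) (L : Set (List B)), P B L → P A {w | smap nx o s w ∈ L}

theorem smap_casc {A B S T : Type} (n1 : S → A → S) (n2 : T → A × S → T)
    (o : S × T → A → B) (s : S) (t : T) (w : List A) :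
    smap n2 (fun y p => o (p.2, y) p.1) t (smap n1 (fun x a => (a, x)) s w) =
      smap (fun (p : S × T) a => (n1 p.1 a, n2 p.2 (a, p.1))) o (s, t) w := by
  induction w generalizing s t with
  | nil => rfl
  | cons a w ih => simp [smap, ih]

theorem Good.casc {P} {A S T : Type} [Finite A] [Finite S] {n1 : S → A → S} {s : S}
    {n2 : T → A × S → T} {t : T} (h1 : Good P n1 s) (h2 : Good P n2 t) :
    Good P (fun (p : S × T) a => (n1 p.1 a, n2 p.2 (a, p.1))) (s, t) := by
  intro B _ o L hL
  have := h1 (A × S) (fun x a => (a, x)) _ (h2 B (fun y p => o (p.2, y) p.1) L hL)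
  simpa only [Set.mem_ofPred_eq, smap_casc] using this

theorem smap_hom {A B S T : Type} (n1 : S → A → S) (n2 : T → A → T) (I : S → Prop) (f : S → T)
    (hI : ∀ s a, I s → I (n1 s a)) (hf : ∀ s a, I s → f (n1 s a) = n2 (f s) a)
    (o : T → A → B) (s : S) (hs : I s) (w : List A) :
    smap n2 o (f s) w = smap n1 (fun s a => o (f s) a) s w := by
  induction w generalizing s with
  | nil => rfl
  | cons a w ih => simp [smap, ← hf s a hs, ih _ (hI s a hs)]

theorem Good.hom {P} {A S T : Type} {n1 : S → A → S} {s : S} (h : Good P n1 s)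
    (n2 : T → A → T) (I : S → Prop) (f : S → T)
    (hI : ∀ s a, I s → I (n1 s a)) (hf : ∀ s a, I s → f (n1 s a) = n2 (f s) a)
    (hs : I s) (t : T) (ht : f s = t) : Good P n2 t := by
  subst ht
  intro B _ o L hL
  have := h B (fun s a => o (f s) a) L hL
  simpa only [smap_hom n1 n2 I f hI hf o s hs] using this

/-- Aperiodicity of a monoid. -/
def Aper (M : Type) [Monoid M] : Prop := ∀ x : M, ∃ n : ℕ, x ^ (n + 1) = x ^ n

/-- The local divisor of a monoid at `c`. -/
@[ext] structure LocDiv {M : Type} [Monoid M] (c : M) : Type where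
  val : M
  left : ∃ y, val = c * y
  right : ∃ y, val = y * c

namespace LocDiv
variable {M : Type} [Monoid M] {c : M}

/-- Multiplication of the local divisor. -/
noncomputable def mul' (x y : LocDiv c) : LocDiv c where
  val := x.val * y.left.choose
  left := by
    obtain ⟨z, hz⟩ := x.left
    exact ⟨z * y.left.choose, by rw [hz, mul_assoc]⟩
  right := by
    obtain ⟨z', hz'⟩ := x.right
    obtain ⟨t, ht⟩ := y.right
    have hy := y.left.choose_spec
    refine ⟨z' * t, ?_⟩
    rw [mul_assoc, ← ht]
    conv_rhs => rw [hy]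
    rw [hz', mul_assoc]

theorem mul'_val (x y : LocDiv c) (z : M) (hz : y.val = c * z) : (mul' x y).val = x.val * z := by
  obtain ⟨t, ht⟩ := x.right
  have hy := y.left.choose_spec
  change x.val * y.left.choose = _
  rw [ht, mul_assoc, ← hy, hz, mul_assoc]

noncomputable instance : Monoid (LocDiv c) where
  mul := mul'
  one := ⟨c, ⟨1, by simp⟩, ⟨1, by simp⟩⟩
  mul_assoc x y z := by
    obtain ⟨y', hy⟩ := y.left
    obtain ⟨z', hz⟩ := z.left
    apply LocDiv.ext
    change (mul' (mul' x y) z).val = (mul' x (mul' y z)).val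
    rw [mul'_val _ _ z' hz, mul'_val _ _ y' hy, mul'_val _ _ (y' * z'), mul_assoc]
    rw [mul'_val _ _ z' hz, hy, mul_assoc]
  one_mul x := by
    obtain ⟨y, hy⟩ := x.left
    apply LocDiv.ext
    change (mul' _ x).val = _
    rw [mul'_val _ _ y hy, hy]
    rfl
  mul_one x := by
    apply LocDiv.ext
    change (mul' x _).val = _
    rw [mul'_val _ _ 1 (mul_one c).symm, mul_one]

theorem one_val : (1 : LocDiv c).val = c := rfl

theorem mul_val (x y : LocDiv c) (z : M) (hz : y.val = c * z) : (x * y).val = x.val * z :=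
  mul'_val x y z hz

theorem aper (h : Aper M) : Aper (LocDiv c) := by
  intro x
  obtain ⟨y, hy⟩ := x.left
  obtain ⟨n, hn⟩ := h y
  have key : ∀ k : ℕ, (x ^ k).val = c * y ^ k := by
    intro k
    induction k with
    | zero => simp [one_val]
    | succ k ih => rw [pow_succ, mul_val _ _ y hy, ih, pow_succ, mul_assoc]
  exact ⟨n, LocDiv.ext (by rw [key, key, hn])⟩

theorem val_injective : Function.Injective (LocDiv.val : LocDiv c → M) := fun _ _ h => LocDiv.ext h

instance [Finite M] : Finite (LocDiv c) := Finite.of_injective _ val_injective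

theorem card_lt [Finite M] (h : Aper M) (hc : c ≠ 1) : Nat.card (LocDiv c) < Nat.card M := by
  have : Fintype M := Fintype.ofFinite _
  have : Fintype (LocDiv c) := Fintype.ofFinite _
  rw [Nat.card_eq_fintype_card, Nat.card_eq_fintype_card]
  refine Fintype.card_lt_of_injective_of_notMem (b := 1) LocDiv.val val_injective ?_
  rintro ⟨⟨_, ⟨y, hy⟩, -⟩, rfl⟩
  obtain ⟨n, hn⟩ := h c
  have : ∀ k : ℕ, c ^ k * y ^ k = 1 := by
    intro k
    induction k with
    | zero => simp
    | succ k ih => rw [pow_succ, pow_succ', mul_assoc, ← mul_assoc c y, ← hy, one_mul, ih]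
  apply hc
  have h2 := this n
  rw [← hn, pow_succ', mul_assoc, this n, mul_one] at h2
  exact h2

end LocDiv

/-- Next-state map of a monoid register with resets. -/
def rnx {A M : Type} [Monoid M] (g : A → Option M) (m : M) (a : A) : M :=
  match g a with
  | none => 1
  | some x => m * x

theorem good_ff {P} (hP : LangClass P) {A V : Type} [Finite A] [Finite V] (u : A → Option V) (v : V) :
    Good P (fun v a => (u a).getD v) v :=
  fun B _ o L hL => hP.ff A B V u o v L hL

theorem good_monoid {P} (hP : LangClass P) (N : ℕ) :
    ∀ (M : Type) [Monoid M] [Finite M], Aper M → Nat.card M ≤ N → ∀ (k : ℕ) (G : Finset M), G.card ≤ k →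
    ∀ (A : Type) [Finite A] (g : A → Option M), (∀ a m, g a = some m → m = 1 ∨ m ∈ G) →
    Good P (rnx g) 1 := by
  classical
  induction N with
  | zero =>
    intro M _ _ _ hN
    have : 0 < Nat.card M := Nat.card_pos
    omega
  | succ N ihN =>
  intro M _ _ hM hN k
  induction k with
  | zero =>
    intro G hG A _ g hg
    have hG' : G = ∅ := by simpa using hG
    subst hG'
    refine (good_ff hP (V := Unit) (fun _ : A => none) ()).hom (rnx g) (fun _ => True) (fun _ => 1)
      (by simp) ?_ trivial 1 rfl
    intro s a _
    unfold rnx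
    rcases h : g a with _ | m
    · rfl
    · have := hg a m h
      simp at this
      simp [this]
  | succ k ihk =>
    intro G hG A _ g hg
    by_cases hc : ∃ c ∈ G, c ≠ 1
    swap
    · push Not at hc
      refine ihk ∅ (by simp) A g ?_
      intro a m ham
      rcases hg a m ham with h | h
      · exact Or.inl h
      · exact Or.inl (hc m h)
    obtain ⟨c, hcG, hc1⟩ := hc
    let g1 : A → Option M := fun a => if g a = some c then none else g a
    have h1 : Good P (rnx g1) 1 := by
      refine ihk (G.erase c) ?_ A g1 ?_
      · rw [Finset.card_erase_of_mem hcG]; omega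
      · intro a m ham
        by_cases h : g a = some c
        · simp [g1, h] at ham
        · simp only [g1, h, if_false] at ham
          rcases hg a m ham with h' | h'
          · exact Or.inl h'
          · refine Or.inr (Finset.mem_erase.2 ⟨?_, h'⟩)
            rintro rfl; exact h ham
    have h2 := good_ff hP (A := A × M) (V := Bool) (fun p => if g p.1 = none then some false else
      if g p.1 = some c then some true else none) false
    have h3 := good_ff hP (A := A × (M × Bool)) (V := M) (fun p =>
      if g p.1 = some c ∧ p.2.2 = false then some p.2.1 else none) 1
    have h4 : Good P (rnx (A := A × ((M × Bool) × M)) (M := LocDiv c) (fun p =>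
        if g p.1 = none then none else
        if g p.1 = some c ∧ p.2.1.2 = true then
          some ⟨c * p.2.1.1 * c, ⟨p.2.1.1 * c, by rw [mul_assoc]⟩, ⟨_, rfl⟩⟩ else some 1)) 1 := by
      have hcard := LocDiv.card_lt hM hc1
      have : Fintype (LocDiv c) := Fintype.ofFinite _
      exact ihN (LocDiv c) (LocDiv.aper hM) (by omega) _ Finset.univ le_rfl _ _
        (fun a m _ => Or.inr (Finset.mem_univ _))
    have h := ((h1.casc h2).casc h3).casc h4
    refine h.hom (rnx g) (fun s => s.1.1.2 = false → s.2 = 1)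
      (fun s => if s.1.1.2 then s.1.2 * s.2.val * s.1.1.1 else s.1.1.1) ?_ ?_ (by simp) 1 (by simp)
    · rintro ⟨⟨⟨t, b⟩, v⟩, m⟩ a hI
      rcases hga : g a with _ | x
      · simp [rnx, hga]
      · by_cases hx : x = c
        · subst hx; simp [rnx, hga]
        · simp [rnx, hga, hx]; exact hI
    · rintro ⟨⟨⟨t, b⟩, v⟩, m⟩ a hI
      rcases hga : g a with _ | x
      · simp [rnx, hga, g1]
      · by_cases hx : x = c
        · subst hx
          cases b
          · have hI' := hI rfl
            simp only at hI'
            simp [rnx, hga, g1, hI', LocDiv.one_val]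
          · simp only [rnx, hga, g1]
            simp
            rw [LocDiv.mul_val _ _ (t * x) (by simp [mul_assoc])]
            simp [mul_assoc]
        · simp [rnx, hga, hx, g1]
          cases b <;> simp [mul_assoc]

theorem smap_last {A S : Type} (nx : S → A → S) (s : S) (w : List A) :
    ((smap nx nx s w).getLast?).getD s = w.foldl nx s := by
  induction w generalizing s with
  | nil => rfl
  | cons a w ih =>
    rw [List.foldl_cons, ← ih]
    simp only [smap]
    rcases h : smap nx nx (nx s a) w with _ | ⟨b, l⟩
    · rfl
    · rw [List.getLast?_cons_cons]
      rcases hl : (b :: l).getLast? with _ | y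
      · simp at hl
      · rfl

/-- A finite semiautomaton all of whose word actions are aperiodic recognizes only languages
in any closed class. -/
theorem class_of_monoid {P} (hP : LangClass P) {A M : Type} [Finite A] [Monoid M] [Finite M]
    (hM : Aper M) (g : A → M) (R : M → Prop) : P A {w | R ((w.map g).prod)} := by
  have : Fintype M := Fintype.ofFinite _
  have h := good_monoid hP _ M hM le_rfl _ Finset.univ le_rfl A (fun a => some (g a))
    (fun a m _ => Or.inr (Finset.mem_univ _))
  have h' := h M (rnx fun a => some (g a)) _ (hP.last M (fun x => R (x.getD 1)))
  simp only [Set.mem_ofPred_eq, smap_last] at h'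
  convert h' using 3 with w
  have : ∀ (w : List A) (m : M), w.foldl (rnx fun a => some (g a)) m = m * (w.map g).prod := by
    intro w
    induction w with
    | nil => simp
    | cons a w ih => intro m; simp [ih, rnx, mul_assoc]
  rw [this, one_mul]

section SF
variable {A : Type}

/-- Concatenation of languages. -/
def cat (L M : Set (List A)) : Set (List A) := {w | ∃ u ∈ L, ∃ v ∈ M, w = u ++ v}

theorem SF.cat {L M : Set (List A)} (hL : StarFree L) (hM : StarFree M) : StarFree (cat L M) :=
  StarFree.concat hL hM

theorem SF.empty : StarFree (∅ : Set (List A)) := StarFree.of_finite _ Set.finite_empty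

theorem SF.univ : StarFree (Set.univ : Set (List A)) := by
  have := (SF.empty (A := A)).compl
  rwa [Set.compl_empty] at this

theorem SF.inter {L M : Set (List A)} (hL : StarFree L) (hM : StarFree M) : StarFree (L ∩ M) := by
  have := (hL.compl.union hM.compl).compl
  rwa [Set.compl_union, compl_compl, compl_compl] at this

theorem SF.iUnion {V : Type} [Finite V] (L : V → Set (List A)) (h : ∀ v, StarFree (L v)) :
    StarFree (⋃ v, L v) := by
  classical
  have : Fintype V := Fintype.ofFinite _
  have key : ∀ s : Finset V, StarFree (⋃ v ∈ s, L v) := by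
    intro s
    induction s using Finset.induction_on with
    | empty => simpa using SF.empty
    | insert a s _ ih =>
      rw [Finset.set_biUnion_insert]
      exact (h a).union ih
  simpa using key Finset.univ

theorem SF.single [Finite A] (p : A → Prop) : StarFree {w : List A | ∃ a, p a ∧ w = [a]} := by
  apply StarFree.of_finite
  apply (Set.finite_range (fun a : A => [a])).subset
  rintro w ⟨a, -, rfl⟩
  exact ⟨a, rfl⟩

theorem SF.all [Finite A] (p : A → Prop) : StarFree {w : List A | ∀ a ∈ w, p a} := by
  have := (SF.cat (SF.cat SF.univ (SF.single (fun a : A => ¬ p a))) SF.univ).compl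
  convert this using 1
  ext w
  simp only [Set.mem_ofPred_eq, Set.mem_compl_iff, Planar2DFT.cat]
  constructor
  · rintro h ⟨u, ⟨u1, -, u2, ⟨a, ha, rfl⟩, rfl⟩, v, -, rfl⟩
    exact ha (h a (by simp))
  · intro h a ha
    by_contra hn
    obtain ⟨s, t, rfl⟩ := List.append_of_mem ha
    exact h ⟨s ++ [a], ⟨s, trivial, [a], ⟨a, hn, rfl⟩, rfl⟩, t, trivial, by simp⟩

theorem SF.state [Finite A] {V : Type} (u : A → Option V) (v v' : V) :
    StarFree {w : List A | w.foldl (fun v a => (u a).getD v) v = v'} := by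
  have h2 := SF.cat (SF.cat SF.univ (SF.single (fun a : A => u a = some v')))
    (SF.all (fun a => u a = none))
  have h1 : StarFree {w : List A | v = v' ∧ ∀ a ∈ w, u a = none} := by
    by_cases h : v = v'
    · simpa [h] using SF.all (fun a => u a = none)
    · simpa [h] using SF.empty
  convert h1.union h2 using 1
  ext w
  simp only [Set.mem_ofPred_eq, Planar2DFT.cat, Set.mem_union]
  induction w using List.reverseRecOn with
  | nil => simp
  | append_singleton w a ih =>
    rw [List.foldl_append]
    simp only [List.foldl_cons, List.foldl_nil]
    rcases hu : u a with _ | x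
    · simp only [Option.getD_none]
      rw [ih]
      apply or_congr
      · simp [or_imp, forall_and, hu]
      · constructor
        · rintro ⟨s, hs, t, ht, rfl⟩
          refine ⟨s, hs, t ++ [a], ?_, by simp⟩
          intro b hb
          rcases List.mem_append.1 hb with hb | hb
          · exact ht b hb
          · rw [List.mem_singleton.1 hb, hu]
        · rintro ⟨s, hs, t, ht, he⟩
          induction t using List.reverseRecOn with
          | nil =>
            obtain ⟨s1, -, s2, ⟨b, hb, rfl⟩, rfl⟩ := hs
            simp at he
            rw [← he.2, hu] at hb
            simp at hb
          | append_singleton t b _ =>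
            rw [← List.append_assoc] at he
            have := List.append_inj' he rfl
            exact ⟨s, hs, t, fun b hb => ht b (by simp [hb]), this.1⟩
    · simp only [Option.getD_some]
      constructor
      · rintro rfl
        right
        exact ⟨w ++ [a], ⟨w, trivial, [a], ⟨a, hu, rfl⟩, rfl⟩, [], by simp, by simp⟩
      · rintro (⟨-, h⟩ | ⟨s, hs, t, ht, he⟩)
        · have := h a (by simp)
          simp [hu] at this
        · induction t using List.reverseRecOn with
          | nil =>
            obtain ⟨s1, -, s2, ⟨b, hb, rfl⟩, rfl⟩ := hs
            simp at he
            rw [← he.2, hu] at hb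
            simpa using hb
          | append_singleton t b _ =>
            rw [← List.append_assoc] at he
            have := List.append_inj' he rfl
            have hb := ht b (by simp)
            simp at this
            rw [← this.2, hu] at hb
            simp at hb

theorem smap_length {A B S : Type} (nx : S → A → S) (o : S → A → B) (s : S) (w : List A) :
    (smap nx o s w).length = w.length := by
  induction w generalizing s with
  | nil => rfl
  | cons a w ih => simp [smap, ih]

theorem smap_append {A B S : Type} (nx : S → A → S) (o : S → A → B) (s : S) (w w' : List A) :
    smap nx o s (w ++ w') = smap nx o s w ++ smap nx o (w.foldl nx s) w' := by
  induction w generalizing s with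
  | nil => rfl
  | cons a w ih => simp [smap, ih]

theorem starFree_class : LangClass (fun _ L => StarFree L) where
  ff := by
    intro A B V _ _ _ u o v L hL
    induction hL generalizing v with
    | of_finite L hL =>
      apply StarFree.of_finite
      obtain ⟨N, hN⟩ := (hL.image List.length).bddAbove
      apply (List.finite_length_le A N).subset
      intro w hw
      change w.length ≤ N
      rw [← smap_length (fun v a => (u a).getD v) o v w]
      exact hN ⟨_, hw, rfl⟩
    | union _ _ h1 h2 => exact (h1 v).union (h2 v)
    | compl _ h => exact (h v).compl
    | @concat L1 L2 _ _ h1 h2 =>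
      have := SF.iUnion (fun v' => cat ({w | smap (fun v a => (u a).getD v) o v w ∈ L1} ∩
        {w : List A | w.foldl (fun v a => (u a).getD v) v = v'})
        {w | smap (fun v a => (u a).getD v) o v' w ∈ L2})
        (fun v' => SF.cat (SF.inter (h1 v) (SF.state u v v')) (h2 v'))
      convert this using 1
      ext w
      simp only [Set.mem_ofPred_eq, Set.mem_iUnion, cat, Set.mem_inter_iff]
      constructor
      · rintro ⟨x, hx, y, hy, hxy⟩
        refine ⟨_, w.take x.length, ⟨?_, rfl⟩, w.drop x.length, ?_, by simp⟩
        all_goals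
          have h := hxy
          rw [← List.take_append_drop x.length w, smap_append] at h
          have hl : (smap (fun v a => (u a).getD v) o v (w.take x.length)).length = x.length := by
            have := congrArg List.length hxy
            simp only [smap_length, List.length_append, List.length_take] at this ⊢
            omega
          have h' := List.append_inj h hl
        · rw [h'.1]; exact hx
        · rw [h'.2]; exact hy
      · rintro ⟨v', x, ⟨hx, rfl⟩, y, hy, rfl⟩
        exact ⟨_, hx, _, hy, smap_append _ _ _ _ _⟩
  last := by
    intro A _ R
    have h1 := SF.cat (SF.univ) (SF.single (fun a : A => R (some a)))
    have h2 : StarFree {w : List A | w = [] ∧ R none} :=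
      StarFree.of_finite _ ((Set.finite_singleton []).subset (fun w hw => hw.1))
    convert h2.union h1 using 1
    ext w
    simp only [Set.mem_ofPred_eq, Planar2DFT.cat, Set.mem_union]
    induction w using List.reverseRecOn with
    | nil => simp
    | append_singleton w a _ =>
      simp only [List.getLast?_append, List.getLast?_singleton, Option.some_or]
      constructor
      · intro h
        exact Or.inr ⟨w, trivial, [a], ⟨a, h, rfl⟩, rfl⟩
      · rintro (⟨h, -⟩ | ⟨s, -, t, ⟨b, hb, rfl⟩, he⟩)
        · simp at h
        · have := List.append_inj' he rfl
          simp at this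
          rw [this.2]; exact hb
end SF

/-- Recognition by a finite aperiodic monoid. -/
def Rec {A : Type} (L : Set (List A)) : Prop :=
  ∃ (M : Type) (_ : Monoid M) (_ : Finite M) (_ : Aper M) (g : A → M) (R : M → Prop),
    L = {w | R ((w.map g).prod)}

/-- Schützenberger product. -/
@[ext] structure Sch (M N : Type) where
  a : M
  S : Set (M × N)
  b : N

namespace Sch
variable {M N : Type} [Monoid M] [Monoid N]

instance : Monoid (Sch M N) where
  mul x y := ⟨x.a * y.a, {p | (∃ q ∈ y.S, p = (x.a * q.1, q.2)) ∨ (∃ q ∈ x.S, p = (q.1, q.2 * y.b))},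
    x.b * y.b⟩
  one := ⟨1, ∅, 1⟩
  mul_assoc x y z := by
    apply Sch.ext
    · exact mul_assoc _ _ _
    · ext p
      constructor
      · rintro (⟨q, hq, rfl⟩ | ⟨_, ⟨q, hq, rfl⟩ | ⟨q, hq, rfl⟩, rfl⟩)
        · exact Or.inl ⟨_, Or.inl ⟨q, hq, rfl⟩, by simp only [← mul_assoc]; rfl⟩
        · exact Or.inl ⟨_, Or.inr ⟨q, hq, rfl⟩, rfl⟩
        · exact Or.inr ⟨q, hq, by simp only [mul_assoc]; rfl⟩
      · rintro (⟨_, ⟨q, hq, rfl⟩ | ⟨q, hq, rfl⟩, rfl⟩ | ⟨q, hq, rfl⟩)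
        · exact Or.inl ⟨q, hq, by simp only [← mul_assoc]; rfl⟩
        · exact Or.inr ⟨_, Or.inl ⟨q, hq, rfl⟩, rfl⟩
        · exact Or.inr ⟨_, Or.inr ⟨q, hq, rfl⟩, by simp only [mul_assoc]; rfl⟩
    · exact mul_assoc _ _ _
  one_mul x := by
    apply Sch.ext
    · exact one_mul _
    · ext p
      constructor
      · rintro (⟨q, hq, rfl⟩ | ⟨q, hq, rfl⟩)
        · have : (1 : M) * q.1 = q.1 := one_mul _
          change ((1 : M) * q.1, q.2) ∈ x.S
          rw [this]; exact hq
        · exact hq.elim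
      · intro hp
        exact Or.inl ⟨p, hp, by change p = ((1 : M) * p.1, p.2); rw [one_mul]⟩
    · exact one_mul _
  mul_one x := by
    apply Sch.ext
    · exact mul_one _
    · ext p
      constructor
      · rintro (⟨q, hq, rfl⟩ | ⟨q, hq, rfl⟩)
        · exact hq.elim
        · change (q.1, q.2 * (1 : N)) ∈ x.S
          rw [mul_one]; exact hq
      · intro hp
        exact Or.inr ⟨p, hp, by change p = (p.1, p.2 * (1 : N)); rw [mul_one]⟩
    · exact mul_one _

theorem mul_a (x y : Sch M N) : (x * y).a = x.a * y.a := rfl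
theorem mul_b (x y : Sch M N) : (x * y).b = x.b * y.b := rfl
theorem mem_mul (x y : Sch M N) (p : M × N) : p ∈ (x * y).S ↔
    (∃ q ∈ y.S, p = (x.a * q.1, q.2)) ∨ (∃ q ∈ x.S, p = (q.1, q.2 * y.b)) := Iff.rfl
theorem one_a : (1 : Sch M N).a = 1 := rfl
theorem one_b : (1 : Sch M N).b = 1 := rfl
theorem one_S : (1 : Sch M N).S = ∅ := rfl

theorem pow_a (x : Sch M N) (n : ℕ) : (x ^ n).a = x.a ^ n := by
  induction n with
  | zero => simp [one_a]
  | succ n ih => rw [pow_succ, pow_succ, mul_a, ih]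
theorem pow_b (x : Sch M N) (n : ℕ) : (x ^ n).b = x.b ^ n := by
  induction n with
  | zero => simp [one_b]
  | succ n ih => rw [pow_succ, pow_succ, mul_b, ih]

theorem mem_pow (x : Sch M N) (n : ℕ) (p : M × N) : p ∈ (x ^ n).S ↔
    ∃ i j, i + j + 1 = n ∧ ∃ q ∈ x.S, p = (x.a ^ i * q.1, q.2 * x.b ^ j) := by
  induction n generalizing p with
  | zero => simp [one_S]
  | succ n ih =>
    rw [pow_succ, mem_mul]
    constructor
    · rintro (⟨q, hq, rfl⟩ | ⟨q, hq, rfl⟩)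
      · exact ⟨n, 0, rfl, q, hq, by simp [pow_a]⟩
      · obtain ⟨i, j, h, r, hr, rfl⟩ := (ih q).1 hq
        exact ⟨i, j + 1, by omega, r, hr, by simp [pow_succ, mul_assoc]⟩
    · rintro ⟨i, j, h, q, hq, rfl⟩
      rcases j with _ | j
      · obtain rfl : i = n := by omega
        exact Or.inl ⟨q, hq, by simp [pow_a]⟩
      · exact Or.inr ⟨_, (ih _).2 ⟨i, j, by omega, q, hq, rfl⟩, by simp [pow_succ, mul_assoc]⟩

instance [Finite M] [Finite N] : Finite (Sch M N) :=
  Finite.of_injective (fun x : Sch M N => (x.a, x.S, x.b)) (by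
    intro x y h
    simp only [Prod.mk.injEq] at h
    exact Sch.ext h.1 h.2.1 h.2.2)

theorem pow_stab {M : Type} [Monoid M] {x : M} {n : ℕ} (h : x ^ (n + 1) = x ^ n) (k : ℕ) (hk : n ≤ k) :
    x ^ (k + 1) = x ^ k := by
  obtain ⟨d, rfl⟩ := Nat.exists_eq_add_of_le hk
  rw [show n + d + 1 = (n + 1) + d by omega, pow_add, h, pow_add]

theorem aper (hM : Aper M) (hN : Aper N) : Aper (Sch M N) := by
  intro x
  obtain ⟨m, hm⟩ := hM x.a
  obtain ⟨n, hn⟩ := hN x.b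
  refine ⟨m + n + 1, ?_⟩
  apply Sch.ext
  · rw [pow_a, pow_a]; exact pow_stab hm _ (by omega)
  · ext p
    rw [mem_pow, mem_pow]
    constructor
    · rintro ⟨i, j, h, q, hq, rfl⟩
      by_cases hi : m < i
      · obtain ⟨i, rfl⟩ : ∃ i', i = i' + 1 := ⟨i - 1, by omega⟩
        refine ⟨i, j, by omega, q, hq, ?_⟩
        rw [pow_stab hm i (by omega)]
      · obtain ⟨j, rfl⟩ : ∃ i', j = i' + 1 := ⟨j - 1, by omega⟩
        refine ⟨i, j, by omega, q, hq, ?_⟩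
        rw [pow_stab hn j (by omega)]
    · rintro ⟨i, j, h, q, hq, rfl⟩
      by_cases hi : m ≤ i
      · refine ⟨i + 1, j, by omega, q, hq, ?_⟩
        rw [pow_stab hm i (by omega)]
      · refine ⟨i, j + 1, by omega, q, hq, ?_⟩
        rw [pow_stab hn j (by omega)]
  · rw [pow_b, pow_b]; exact pow_stab hn _ (by omega)

end Sch

/-- The three-element monoid used for single letters. -/
inductive Three where
  | one | a | zero

instance : Fintype Three := ⟨⟨{Three.one, Three.a, Three.zero}, by simp⟩, by intro x; cases x <;> simp⟩

instance : Monoid Three where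
  mul x y := match x, y with
    | .one, y => y
    | x, .one => x
    | _, _ => .zero
  one := .one
  mul_assoc x y z := by cases x <;> cases y <;> cases z <;> rfl
  one_mul x := by cases x <;> rfl
  mul_one x := by cases x <;> rfl

theorem Rec.compl {A : Type} {L : Set (List A)} (h : Rec L) : Rec Lᶜ := by
  obtain ⟨M, i1, i2, h, g, R, rfl⟩ := h
  exact ⟨M, i1, i2, h, g, fun m => ¬ R m, rfl⟩

theorem Aper.prod {M N : Type} [Monoid M] [Monoid N] (hM : Aper M) (hN : Aper N) : Aper (M × N) := by
  rintro ⟨x, y⟩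
  obtain ⟨m, hm⟩ := hM x
  obtain ⟨n, hn⟩ := hN y
  refine ⟨m + n, ?_⟩
  rw [Prod.pow_mk, Prod.pow_mk, Sch.pow_stab hm _ (by omega), Sch.pow_stab hn _ (by omega)]

theorem Rec.union {A : Type} {L K : Set (List A)} (h : Rec L) (h' : Rec K) : Rec (L ∪ K) := by
  obtain ⟨M, i1, i2, h, g, R, rfl⟩ := h
  obtain ⟨N, j1, j2, h', g', R', rfl⟩ := h'
  refine ⟨M × N, inferInstance, inferInstance, h.prod h', fun a => (g a, g' a),
    fun m => R m.1 ∨ R' m.2, ?_⟩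
  have : ∀ w : List A, (w.map (fun a => (g a, g' a))).prod = ((w.map g).prod, (w.map g').prod) := by
    intro w
    induction w with
    | nil => rfl
    | cons a w ih => simp [ih]
  ext w
  simp [this]

theorem Rec.cat {A : Type} {L K : Set (List A)} (h : Rec L) (h' : Rec K) : Rec (cat L K) := by
  obtain ⟨M, i1, i2, h, g, R, rfl⟩ := h
  obtain ⟨N, j1, j2, h', g', R', rfl⟩ := h'
  let G : A → Sch M N := fun a => ⟨g a, {(g a, 1)}, g' a⟩
  have ha : ∀ w : List A, ((w.map G).prod).a = (w.map g).prod := by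
    intro w
    induction w with
    | nil => rfl
    | cons a w ih => simp [Sch.mul_a, ih, G]
  have hb : ∀ w : List A, ((w.map G).prod).b = (w.map g').prod := by
    intro w
    induction w with
    | nil => rfl
    | cons a w ih => simp [Sch.mul_b, ih, G]
  have hS : ∀ (w : List A) p, p ∈ ((w.map G).prod).S ↔
      ∃ u v, u ≠ [] ∧ w = u ++ v ∧ p = ((u.map g).prod, (v.map g').prod) := by
    intro w
    induction w with
    | nil =>
      intro p
      simp only [List.map_nil, List.prod_nil, Sch.one_S, Set.mem_empty_iff_false, false_iff]
      rintro ⟨u, v, hu, he, -⟩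
      simp at he
      exact hu he.1
    | cons a w ih =>
      intro p
      rw [List.map_cons, List.prod_cons, Sch.mem_mul]
      constructor
      · rintro (⟨q, hq, rfl⟩ | ⟨q, hq, rfl⟩)
        · obtain ⟨u, v, hu, rfl, rfl⟩ := (ih q).1 hq
          exact ⟨a :: u, v, by simp, by simp, by simp [G]⟩
        · refine ⟨[a], w, by simp, by simp, ?_⟩
          have : q = (g a, 1) := hq
          rw [hb, this]; simp
      · rintro ⟨u, v, hu, he, rfl⟩
        rcases u with _ | ⟨b, u⟩
        · exact (hu rfl).elim
        · simp only [List.cons_append, List.cons.injEq] at he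
          obtain ⟨rfl, rfl⟩ := he
          by_cases hu' : u = []
          · subst hu'
            right
            exact ⟨(g a, 1), rfl, by rw [hb]; simp⟩
          · left
            exact ⟨_, (ih _).2 ⟨u, v, hu', rfl, rfl⟩, by simp [G]⟩
  refine ⟨Sch M N, inferInstance, inferInstance, Sch.aper h h', G,
    fun m => (R 1 ∧ R' m.b) ∨ ∃ p ∈ m.S, R p.1 ∧ R' p.2, ?_⟩
  ext w
  simp only [Planar2DFT.cat, Set.mem_ofPred_eq, hb]
  constructor
  · rintro ⟨u, hu, v, hv, rfl⟩
    by_cases hu' : u = []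
    · subst hu'
      left
      exact ⟨hu, hv⟩
    · right
      exact ⟨_, (hS _ _).2 ⟨u, v, hu', rfl, rfl⟩, hu, hv⟩
  · rintro (⟨h1, h2⟩ | ⟨p, hp, h1, h2⟩)
    · exact ⟨[], h1, w, h2, rfl⟩
    · obtain ⟨u, v, -, rfl, rfl⟩ := (hS _ _).1 hp
      exact ⟨u, h1, v, h2, rfl⟩

theorem Three.aper : Aper Three := by
  intro x
  refine ⟨2, ?_⟩
  cases x <;> rfl

theorem three_prod {A : Type} (g : A → Three) (hg : ∀ a, g a ≠ 1) (w : List A) :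
    ((w.map g).prod = 1 ↔ w = []) ∧ ((w.map g).prod = Three.a ↔ ∃ a, w = [a] ∧ g a = Three.a) := by
  have h1 : ∀ w : List A, ((w.map g).prod = 1 ↔ w = []) := by
    intro w
    rcases w with _ | ⟨a, w⟩
    · simp
    · simp only [List.map_cons, List.prod_cons, reduceCtorEq, iff_false]
      have := hg a
      generalize g a = x at *
      generalize (w.map g).prod = y
      cases x <;> cases y <;> first | exact (this rfl).elim | exact fun h => nomatch h
  refine ⟨h1 w, ?_⟩
  rcases w with _ | ⟨a, w⟩
  · simp only [List.map_nil, List.prod_nil]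
    constructor
    · exact fun h => nomatch h
    · rintro ⟨a, h, -⟩; simp at h
  · have h2 := h1 w
    simp only [List.map_cons, List.prod_cons]
    constructor
    · intro h
      have h3 : (w.map g).prod = 1 := by
        have := hg a
        generalize g a = x at *
        generalize (w.map g).prod = y at *
        cases x <;> cases y <;> first | rfl | exact (this rfl).elim | exact nomatch h
      have h4 := h2.1 h3
      subst h4
      exact ⟨a, rfl, by simpa using h⟩
    · rintro ⟨b, h, hb⟩
      simp at h
      obtain ⟨rfl, rfl⟩ := h
      simpa using hb

theorem Rec.nil {A : Type} : Rec ({[]} : Set (List A)) := by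
  refine ⟨Three, inferInstance, inferInstance, Three.aper, fun _ => Three.zero, fun m => m = 1, ?_⟩
  ext w
  exact ((three_prod (fun _ : A => Three.zero) (fun a h => nomatch h) w).1).symm

theorem Rec.letter {A : Type} (a : A) : Rec ({[a]} : Set (List A)) := by
  classical
  refine ⟨Three, inferInstance, inferInstance, Three.aper,
    fun b => if b = a then Three.a else Three.zero, fun m => m = Three.a, ?_⟩
  ext w
  have := (three_prod (fun b : A => if b = a then Three.a else Three.zero)
    (fun b h => by split_ifs at h <;> exact nomatch h) w).2
  simp only [Set.mem_ofPred_eq]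
  rw [this, Set.mem_singleton_iff]
  constructor
  · rintro rfl; exact ⟨a, rfl, by simp⟩
  · rintro ⟨b, rfl, hb⟩
    split_ifs at hb with h
    rw [h]

theorem Rec.word {A : Type} (w : List A) : Rec ({w} : Set (List A)) := by
  induction w with
  | nil => exact Rec.nil
  | cons a w ih =>
    have := (Rec.letter a).cat ih
    convert this using 1
    ext v
    simp [Planar2DFT.cat]

theorem StarFree.rec' {A : Type} {L : Set (List A)} (h : StarFree L) : Rec L := by
  induction h with
  | of_finite L hL =>
    induction L, hL using Set.Finite.induction_on with
    | empty =>
      have := (Rec.nil (A := A)).union (Rec.nil.compl)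
      rw [Set.union_compl_self] at this
      have := this.compl
      rwa [Set.compl_univ] at this
    | insert _ _ ih => exact (Rec.word _).union ih
  | union _ _ h1 h2 => exact h1.union h2
  | compl _ h => exact h.compl
  | concat _ _ h1 h2 => exact h1.cat h2

open Relation

/-! ### Profiles and their composition -/

/-- A profile between `P` and `Q`: a directed graph on `P ⊕ Q`. -/
abbrev Prof (P Q : Type) := P ⊕ Q → P ⊕ Q → Prop

inductive Nd (P Q R : Type) where
  | l : P → Nd P Q R
  | m : Q → Nd P Q R
  | r : R → Nd P Q R

section
variable {P Q R S : Type}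

def e12 : P ⊕ Q → Nd P Q R
  | Sum.inl p => Nd.l p
  | Sum.inr q => Nd.m q

def e23 : Q ⊕ R → Nd P Q R
  | Sum.inl p => Nd.m p
  | Sum.inr q => Nd.r q

def e13 : P ⊕ R → Nd P Q R
  | Sum.inl p => Nd.l p
  | Sum.inr q => Nd.r q

/-- Edges of the glued graph. -/
inductive CE (x : Prof P Q) (f : Prof Q R) : Nd P Q R → Nd P Q R → Prop
  | left {u v} : x u v → CE x f (e12 u) (e12 v)
  | right {u v} : f u v → CE x f (e23 u) (e23 v)

/-- Composition of profiles. -/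
def comp (x : Prof P Q) (f : Prof Q R) : Prof P R :=
  fun u v => TransGen (CE x f) (e13 u) (e13 v)

inductive N4 (P Q R S : Type) where
  | a : P → N4 P Q R S
  | b : Q → N4 P Q R S
  | c : R → N4 P Q R S
  | d : S → N4 P Q R S

def k123 : Nd P Q R → N4 P Q R S
  | Nd.l p => N4.a p
  | Nd.m p => N4.b p
  | Nd.r p => N4.c p

def k134 : Nd P R S → N4 P Q R S
  | Nd.l p => N4.a p
  | Nd.m p => N4.c p
  | Nd.r p => N4.d p

def k124 : Nd P Q S → N4 P Q R S
  | Nd.l p => N4.a p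
  | Nd.m p => N4.b p
  | Nd.r p => N4.d p

def k234 : Nd Q R S → N4 P Q R S
  | Nd.l p => N4.b p
  | Nd.m p => N4.c p
  | Nd.r p => N4.d p

inductive E4 (x : Prof P Q) (f : Prof Q R) (g : Prof R S) :
    N4 P Q R S → N4 P Q R S → Prop
  | h1 {u v} : x u v → E4 x f g (k123 (e12 u)) (k123 (e12 v))
  | h2 {u v} : f u v → E4 x f g (k123 (e23 u)) (k123 (e23 v))
  | h3 {u v} : g u v → E4 x f g (k234 (e23 u)) (k234 (e23 v))

theorem k134_12 (u : P ⊕ R) : (k134 (e12 u) : N4 P Q R S) = k123 (e13 u) := by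
  cases u <;> rfl
theorem k134_23 (u : R ⊕ S) : (k134 (e23 u) : N4 P Q R S) = k234 (e23 u) := by
  cases u <;> rfl
theorem k134_13 (u : P ⊕ S) : (k134 (e13 u) : N4 P Q R S) = k124 (e13 u) := by
  cases u <;> rfl
theorem k124_12 (u : P ⊕ Q) : (k124 (e12 u) : N4 P Q R S) = k123 (e12 u) := by
  cases u <;> rfl
theorem k124_23 (u : Q ⊕ S) : (k124 (e23 u) : N4 P Q R S) = k234 (e13 u) := by
  cases u <;> rfl
theorem k234_12 (u : Q ⊕ R) : (k234 (e12 u) : N4 P Q R S) = k123 (e23 u) := by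
  cases u <;> rfl

theorem tg_lift' {α β : Type} {r : α → α → Prop} {p : β → β → Prop} (f : α → β)
    (h : ∀ a b, r a b → TransGen p (f a) (f b)) {a b : α} (hab : TransGen r a b) :
    TransGen p (f a) (f b) := by
  induction hab with
  | single h1 => exact h _ _ h1
  | tail _ h2 ih => exact ih.trans (h _ _ h2)

/-- General hiding lemma. -/
theorem hide {N V W I : Type} {E : N → N → Prop} {F : V → V → Prop} {G : W → W → Prop}
    (ι : V → N) (κ : W → N) (eV : I → V) (eW : I → W)
    (hι : ∀ a b, ι a = ι b → a = b)
    (hκ : ∀ a b, κ a = κ b → a = b)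
    (hI : ∀ i, ι (eV i) = κ (eW i))
    (hIn : ∀ v w, ι v = κ w → ∃ i, v = eV i ∧ w = eW i)
    (hG : ∀ i j, TransGen G (eW i) (eW j) → F (eV i) (eV j))
    (hE : ∀ a b, E a b → (∃ w w', a = κ w ∧ b = κ w' ∧ G w w') ∨
      (∃ v v', a = ι v ∧ b = ι v' ∧ F v v'))
    {u v : V} (h : TransGen E (ι u) (ι v)) : TransGen F u v := by
  have key : ∀ n, TransGen E (ι u) n → (∃ v, n = ι v ∧ TransGen F u v) ∨
      ∃ i w, n = κ w ∧ ReflTransGen F u (eV i) ∧ TransGen G (eW i) w := by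
    intro n hn
    induction hn with
    | single h1 =>
      rcases hE _ _ h1 with ⟨w, w', h2, h3, h4⟩ | ⟨v, v', h2, h3, h4⟩
      · obtain ⟨i, rfl, rfl⟩ := hIn _ _ h2
        exact Or.inr ⟨i, w', h3, .refl, .single h4⟩
      · obtain rfl := hι _ _ h2
        exact Or.inl ⟨v', h3, .single h4⟩
    | tail _ h1 ih =>
      rcases hE _ _ h1 with ⟨w, w', h2, h3, h4⟩ | ⟨v, v', h2, h3, h4⟩
      · rcases ih with ⟨v, h5, h6⟩ | ⟨i, w0, h5, h6, h7⟩
        · obtain ⟨i, rfl, rfl⟩ := hIn _ _ (h5.symm.trans h2)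
          exact Or.inr ⟨i, w', h3, h6.to_reflTransGen, .single h4⟩
        · obtain rfl := hκ _ _ (h5.symm.trans h2)
          exact Or.inr ⟨i, w', h3, h6, h7.tail h4⟩
      · rcases ih with ⟨v1, h5, h6⟩ | ⟨i, w0, h5, h6, h7⟩
        · obtain rfl := hι _ _ (h5.symm.trans h2)
          exact Or.inl ⟨v', h3, h6.tail h4⟩
        · obtain ⟨j, rfl, rfl⟩ := hIn _ _ (h2.symm.trans h5)
          exact Or.inl ⟨v', h3, (TransGen.tail' h6 (hG _ _ h7)).tail h4⟩
  rcases key _ h with ⟨v', h1, h2⟩ | ⟨i, w, h1, h2, h3⟩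
  · obtain rfl := hι _ _ h1
    exact h2
  · obtain ⟨j, rfl, rfl⟩ := hIn _ _ h1
    exact TransGen.tail' h2 (hG _ _ h3)

theorem comp_assoc_left (x : Prof P Q) (f : Prof Q R) (g : Prof R S) (u v : P ⊕ S) :
    comp (comp x f) g u v ↔ TransGen (E4 x f g) (k134 (e13 u)) (k134 (e13 v)) := by
  constructor
  · refine fun h => tg_lift' k134 ?_ h
    rintro _ _ (h | h)
    · rw [k134_12, k134_12]
      refine tg_lift' k123 ?_ h
      rintro _ _ (h | h)
      · exact .single (.h1 h)
      · exact .single (.h2 h)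
    · rw [k134_23, k134_23]
      exact .single (.h3 h)
  · intro h
    refine hide (G := CE x f) k134 k123 e12 e13 ?_ ?_ k134_12 ?_ ?_ ?_ h
    · rintro (_|_|_) (_|_|_) h <;> cases h <;> rfl
    · rintro (_|_|_) (_|_|_) h <;> cases h <;> rfl
    · rintro (a|a|_) (_|_|_) h <;> cases h
      · exact ⟨.inl a, rfl, rfl⟩
      · exact ⟨.inr a, rfl, rfl⟩
    · exact fun i j h => .left h
    · rintro _ _ (h | h | h)
      · exact .inl ⟨_, _, rfl, rfl, .left h⟩
      · exact .inl ⟨_, _, rfl, rfl, .right h⟩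
      · exact .inr ⟨_, _, (k134_23 _).symm, (k134_23 _).symm, .right h⟩

theorem comp_assoc_right (x : Prof P Q) (f : Prof Q R) (g : Prof R S) (u v : P ⊕ S) :
    comp x (comp f g) u v ↔ TransGen (E4 x f g) (k124 (e13 u)) (k124 (e13 v)) := by
  constructor
  · refine fun h => tg_lift' k124 ?_ h
    rintro _ _ (h | h)
    · rw [k124_12, k124_12]
      exact .single (.h1 h)
    · rw [k124_23, k124_23]
      refine tg_lift' k234 ?_ h
      rintro _ _ (h | h)
      · rw [k234_12, k234_12]
        exact .single (.h2 h)
      · exact .single (.h3 h)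
  · intro h
    refine hide (G := CE f g) k124 k234 e23 e13 ?_ ?_ k124_23 ?_ ?_ ?_ h
    · rintro (_|_|_) (_|_|_) h <;> cases h <;> rfl
    · rintro (_|_|_) (_|_|_) h <;> cases h <;> rfl
    · rintro (_|a|a) (_|_|_) h <;> cases h
      · exact ⟨.inl a, rfl, rfl⟩
      · exact ⟨.inr a, rfl, rfl⟩
    · exact fun i j h => .right h
    · rintro _ _ (h | h | h)
      · exact .inr ⟨_, _, (k124_12 _).symm, (k124_12 _).symm, .left h⟩
      · exact .inl ⟨_, _, (k234_12 _).symm, (k234_12 _).symm, .left h⟩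
      · exact .inl ⟨_, _, rfl, rfl, .right h⟩

theorem comp_assoc (x : Prof P Q) (f : Prof Q R) (g : Prof R S) :
    comp (comp x f) g = comp x (comp f g) := by
  funext u v
  apply propext
  rw [comp_assoc_left, comp_assoc_right, k134_13, k134_13]

/-! ### Profiles of transitions -/

def srcN (ρ : Q → Bool) (q : Q) : Q ⊕ Q := if ρ q then .inl q else .inr q
def tgtN (ρ : Q → Bool) (q : Q) : Q ⊕ Q := if ρ q then .inr q else .inl q

inductive prof (ρ : Q → Bool) (f : Set (Q × Q)) : Prof Q Q
  | mk {q r} : (q, r) ∈ f → prof ρ f (srcN ρ q) (tgtN ρ r)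

inductive startP (q : Q) : Prof Unit Q
  | mk : startP q (.inl ()) (.inr q)

variable {A : Type}

/-- Profile of the initial part `t` of the tape, with the start state plugged in. -/
def tprof (M : TwoWayAutomaton Q A) (t : List (Tape A)) : Prof Unit Q :=
  t.foldl (fun x a => comp x (prof M.ρ (M.δ a))) (startP M.init)

theorem tprof_snoc (M : TwoWayAutomaton Q A) (t : List (Tape A)) (a : Tape A) :
    tprof M (t ++ [a]) = comp (tprof M t) (prof M.ρ (M.δ a)) := by
  simp [tprof]

end

section
variable {Q A : Type} (M : TwoWayAutomaton Q A)

theorem step_app {c c' : Config Q A} (h : M.Step c c') (z : List (Tape A)) :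
    M.Step (c.1, c.2.1, c.2.2 ++ z) (c'.1, c'.2.1, c'.2.2 ++ z) := by
  obtain ⟨a, u, v, q, r, hd, h⟩ := h
  refine ⟨a, u, v ++ z, q, r, hd, ?_⟩
  rcases h with ⟨h1, h2, rfl, rfl⟩ | ⟨h1, h2, rfl, rfl⟩ | ⟨h1, h2, rfl, rfl⟩ | ⟨h1, h2, rfl, rfl⟩
  · exact .inl ⟨h1, h2, rfl, rfl⟩
  · exact .inr (.inl ⟨h1, h2, rfl, rfl⟩)
  · exact .inr (.inr (.inl ⟨h1, h2, rfl, rfl⟩))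
  · exact .inr (.inr (.inr ⟨h1, h2, rfl, rfl⟩))

theorem run_app {c c' : Config Q A} (h : ReflTransGen M.Step c c') (z : List (Tape A)) :
    ReflTransGen M.Step (c.1, c.2.1, c.2.2 ++ z) (c'.1, c'.2.1, c'.2.2 ++ z) :=
  ReflTransGen.lift (fun c : Config Q A => ((c.1, c.2.1, c.2.2 ++ z) : Config Q A))
    (fun _ _ h => step_app M h z) _ _ h

theorem step_tape {c c' : Config Q A} (h : M.Step c c') : c'.1 ++ c'.2.2 = c.1 ++ c.2.2 := by
  obtain ⟨a, u, v, q, r, hd, h⟩ := h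
  rcases h with ⟨h1, h2, rfl, rfl⟩ | ⟨h1, h2, rfl, rfl⟩ | ⟨h1, h2, rfl, rfl⟩ | ⟨h1, h2, rfl, rfl⟩ <;>
    simp

theorem run_tape {c c' : Config Q A} (h : ReflTransGen M.Step c c') :
    c'.1 ++ c'.2.2 = c.1 ++ c.2.2 := by
  induction h with
  | refl => rfl
  | tail _ h ih => rw [step_tape M h, ih]

def cfg (t : List (Tape A)) : Unit ⊕ Q → Config Q A
  | .inl _ => ([], M.init, t)
  | .inr q => (t, q, [])

def cfg3 (t : List (Tape A)) (a : Tape A) : Nd Unit Q Q → Config Q A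
  | .l _ => ([], M.init, t ++ [a])
  | .m q => (t, q, [a])
  | .r q => (t ++ [a], q, [])

def srcOK : Unit ⊕ Q → Prop
  | .inl _ => True
  | .inr q => M.ρ q = false

def tgtOK : Unit ⊕ Q → Prop
  | .inl _ => False
  | .inr q => M.ρ q = true

theorem cfg_tape (t : List (Tape A)) (n : Unit ⊕ Q) : (cfg M t n).1 ++ (cfg M t n).2.2 = t := by
  cases n <;> simp [cfg]

theorem srcN_t {ρ : Q → Bool} {q : Q} (h : ρ q = true) : srcN ρ q = .inl q := by simp [srcN, h]
theorem srcN_f {ρ : Q → Bool} {q : Q} (h : ρ q = false) : srcN ρ q = .inr q := by simp [srcN, h]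
theorem tgtN_t {ρ : Q → Bool} {q : Q} (h : ρ q = true) : tgtN ρ q = .inr q := by simp [tgtN, h]
theorem tgtN_f {ρ : Q → Bool} {q : Q} (h : ρ q = false) : tgtN ρ q = .inl q := by simp [tgtN, h]

theorem prof_mk' {ρ : Q → Bool} {f : Set (Q × Q)} {q r : Q} {u v : Q ⊕ Q} (h : (q, r) ∈ f)
    (hu : srcN ρ q = u) (hv : tgtN ρ r = v) : prof ρ f u v := by
  subst hu hv; exact .mk h

theorem tprof_iff (t : List (Tape A)) (s d : Unit ⊕ Q) :
    tprof M t s d ↔ srcOK M s ∧ tgtOK M d ∧ ReflTransGen M.Step (cfg M t s) (cfg M t d) := by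
  induction t using List.reverseRecOn generalizing s d with
  | nil =>
    have hno : ∀ (q : Q) (c : Config Q A), ¬ M.Step ([], q, []) c := by
      rintro q c ⟨a, u, v, q, r, hd, h⟩
      rcases h with ⟨h1, h2, h, _⟩ | ⟨h1, h2, h, _⟩ | ⟨h1, h2, h, _⟩ | ⟨h1, h2, h, _⟩ <;> simp at h
    constructor
    · rintro ⟨⟩
      exact ⟨trivial, M.init_fwd, .refl⟩
    · rintro ⟨h1, h2, h3⟩
      have h4 : cfg M [] s = cfg M [] d := by
        rcases h3.cases_head with h | ⟨c, h, _⟩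
        · exact h
        · exfalso
          cases s <;> exact hno _ _ h
      rcases s with s | s <;> rcases d with d | d <;> simp only [tgtOK, srcOK, cfg] at h1 h2 h4
      · obtain rfl : M.init = d := by simpa using h4
        exact .mk
      · obtain rfl : s = d := by simpa using h4
        simp [h1] at h2
  | append_singleton t a ih =>
    rw [tprof_snoc]
    constructor
    · intro h
      have hl : ∀ u v, CE (tprof M t) (prof M.ρ (M.δ a)) u v →
          ReflTransGen M.Step (cfg3 M t a u) (cfg3 M t a v) := by
        rintro _ _ (h | h)
        · rename_i u v
          obtain ⟨h1, h2, h3⟩ := (ih _ _).1 h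
          have := run_app M h3 [a]
          rcases u with u | u <;> rcases v with v | v <;> exact this
        · obtain @⟨q, r, h⟩ := h
          apply ReflTransGen.single
          cases hq : M.ρ q <;> cases hr : M.ρ r
          · rw [srcN_f hq, tgtN_f hr]
            exact ⟨a, t, [], q, r, h, .inr (.inr (.inl ⟨hq, hr, rfl, rfl⟩))⟩
          · rw [srcN_f hq, tgtN_t hr]
            exact ⟨a, t, [], q, r, h, .inr (.inr (.inr ⟨hq, hr, rfl, rfl⟩))⟩
          · rw [srcN_t hq, tgtN_f hr]
            exact ⟨a, t, [], q, r, h, .inr (.inl ⟨hq, hr, rfl, rfl⟩)⟩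
          · rw [srcN_t hq, tgtN_t hr]
            exact ⟨a, t, [], q, r, h, .inl ⟨hq, hr, rfl, rfl⟩⟩
      refine ⟨?_, ?_, ?_⟩
      · rcases s with s | s
        · trivial
        · obtain ⟨c, h1, _⟩ := TransGen.head'_iff.1 h
          generalize hs : (e13 (Sum.inr s) : Nd Unit Q Q) = n at h1
          rcases h1 with @⟨u, v, h1⟩ | @⟨_, _, @⟨q, r, h1⟩⟩
          · cases u <;> cases hs
          · cases hq : M.ρ q
            · rw [srcN_f hq] at hs
              cases hs; exact hq
            · rw [srcN_t hq] at hs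
              cases hs
      · obtain ⟨c, _, h1⟩ := TransGen.tail'_iff.1 h
        generalize hs : (e13 d : Nd Unit Q Q) = n at h1
        rcases h1 with @⟨u, v, h1⟩ | @⟨_, _, @⟨q, r, h1⟩⟩
        · have := ((ih _ _).1 h1).2.1
          rcases v with v | v <;> rcases d with d | d <;> cases hs
          exact this.elim
        · cases hq : M.ρ r
          · rw [tgtN_f hq] at hs
            cases d <;> cases hs
          · rw [tgtN_t hq] at hs
            cases d <;> cases hs; exact hq
      · have : ∀ u v, TransGen (CE (tprof M t) (prof M.ρ (M.δ a))) u v →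
          ReflTransGen M.Step (cfg3 M t a u) (cfg3 M t a v) := by
          intro u v h
          induction h with
          | single h => exact hl _ _ h
          | tail _ h ih => exact ih.trans (hl _ _ h)
        have := this _ _ h
        rcases s with s | s <;> rcases d with d | d <;> exact this
    · rintro ⟨h1, h2, h3⟩
      rcases d with d | d
      · exact h2.elim
      have inv : ∀ c, ReflTransGen M.Step (cfg M (t ++ [a]) s) c →
        (∃ q, c = (t ++ [a], q, []) ∧
          ((M.ρ q = true ∧ TransGen (CE (tprof M t) (prof M.ρ (M.δ a))) (e13 s) (.r q)) ∨
            (M.ρ q = false ∧ s = .inr q))) ∨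
        (∃ u q v n, c = (u, q, v ++ [a]) ∧ srcOK M n ∧
          ReflTransGen (CE (tprof M t) (prof M.ρ (M.δ a))) (e13 s) (e12 n) ∧
          ReflTransGen M.Step (cfg M t n) (u, q, v)) := by
        intro c hc
        induction hc with
        | refl =>
          rcases s with s | s
          · exact .inr ⟨[], M.init, t, .inl (), rfl, trivial, .refl, .refl⟩
          · exact .inl ⟨s, rfl, .inr ⟨h1, rfl⟩⟩
        | tail hb hs ih' =>
          rcases ih' with ⟨q, rfl, h⟩ | ⟨u, q, v, n, rfl, hn, hr1, hr2⟩
          · obtain ⟨a', u', v', q', r', hd, hh⟩ := hs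
            rcases hh with ⟨g1, g2, g3, rfl⟩ | ⟨g1, g2, g3, rfl⟩ | ⟨g1, g2, g3, rfl⟩ | ⟨g1, g2, g3, rfl⟩
            · simp at g3
            · simp at g3
            · simp only [Prod.mk.injEq, List.append_singleton_inj] at g3
              obtain ⟨⟨rfl, rfl⟩, rfl, rfl⟩ := g3
              rcases h with ⟨h, _⟩ | ⟨h, rfl⟩
              · simp [g1] at h
              refine .inr ⟨t, r', [], .inr r', rfl, g2, ?_, .refl⟩
              exact .single (CE.right (u := .inr q) (v := .inl r') (prof_mk' hd (srcN_f g1) (tgtN_f g2)))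
            · simp only [Prod.mk.injEq, List.append_singleton_inj] at g3
              obtain ⟨⟨rfl, rfl⟩, rfl, rfl⟩ := g3
              rcases h with ⟨h, _⟩ | ⟨h, rfl⟩
              · simp [g1] at h
              refine .inl ⟨r', rfl, .inl ⟨g2, ?_⟩⟩
              exact .single (CE.right (u := .inr q) (v := .inr r') (prof_mk' hd (srcN_f g1) (tgtN_t g2)))
          · have htape : u ++ v = t := by
              have := run_tape M hr2
              rwa [cfg_tape] at this
            obtain ⟨a', u', v', q', r', hd, hh⟩ := hs
            rcases hh with ⟨g1, g2, g3, rfl⟩ | ⟨g1, g2, g3, rfl⟩ | ⟨g1, g2, g3, rfl⟩ | ⟨g1, g2, g3, rfl⟩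
            · simp only [Prod.mk.injEq] at g3
              obtain ⟨rfl, rfl, g3⟩ := g3
              rcases v with _ | ⟨b, v⟩
              · simp only [List.nil_append, List.cons.injEq] at g3
                obtain ⟨rfl, rfl⟩ := g3
                simp only [List.append_nil] at htape
                subst htape
                have e1 := (ih n (.inr q)).2 ⟨hn, g1, hr2⟩
                refine .inl ⟨r', rfl, .inl ⟨g2, ?_⟩⟩
                exact TransGen.tail' (hr1.tail (CE.left e1))
                  (CE.right (u := .inl q) (v := .inr r') (prof_mk' hd (srcN_t g1) (tgtN_t g2)))
              · simp only [List.cons_append, List.cons.injEq] at g3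
                obtain ⟨rfl, rfl⟩ := g3
                refine .inr ⟨u ++ [b], r', v, n, rfl, hn, hr1, hr2.tail ?_⟩
                exact ⟨b, u, v, q, r', hd, .inl ⟨g1, g2, rfl, rfl⟩⟩
            · simp only [Prod.mk.injEq] at g3
              obtain ⟨rfl, rfl, g3⟩ := g3
              rcases v with _ | ⟨b, v⟩
              · simp only [List.nil_append, List.cons.injEq] at g3
                obtain ⟨rfl, rfl⟩ := g3
                simp only [List.append_nil] at htape
                subst htape
                have e1 := (ih n (.inr q)).2 ⟨hn, g1, hr2⟩
                refine .inr ⟨u, r', [], .inr r', rfl, g2, ?_, .refl⟩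
                exact (hr1.tail (CE.left e1)).tail
                  (CE.right (u := .inl q) (v := .inl r') (prof_mk' hd (srcN_t g1) (tgtN_f g2)))
              · simp only [List.cons_append, List.cons.injEq] at g3
                obtain ⟨rfl, rfl⟩ := g3
                refine .inr ⟨u, r', b :: v, n, rfl, hn, hr1, hr2.tail ?_⟩
                exact ⟨b, u, v, q, r', hd, .inr (.inl ⟨g1, g2, rfl, rfl⟩)⟩
            · simp only [Prod.mk.injEq] at g3
              obtain ⟨rfl, rfl, rfl⟩ := g3
              refine .inr ⟨u', r', a' :: v, n, rfl, hn, hr1, hr2.tail ?_⟩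
              exact ⟨a', u', v, q, r', hd, .inr (.inr (.inl ⟨g1, g2, rfl, rfl⟩))⟩
            · simp only [Prod.mk.injEq] at g3
              obtain ⟨rfl, rfl, rfl⟩ := g3
              refine .inr ⟨u' ++ [a'], r', v, n, rfl, hn, hr1, hr2.tail ?_⟩
              exact ⟨a', u', v, q, r', hd, .inr (.inr (.inr ⟨g1, g2, rfl, rfl⟩))⟩
      rcases inv _ h3 with ⟨q, hq, h⟩ | ⟨u, q, v, n, hq, _⟩
      · simp only [cfg, Prod.mk.injEq, true_and, and_true] at hq
        subst hq
        rcases h with ⟨_, h⟩ | ⟨h, _⟩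
        · exact h
        · simp [tgtOK, h] at h2
      · simp [cfg] at hq

theorem accepts_iff (u : List A) :
    M.Accepts u ↔ ∃ qf ∈ M.final, tprof M (tapeOf u) (.inl ()) (.inr qf) := by
  constructor
  · rintro ⟨qf, hqf, h⟩
    refine ⟨qf, hqf, (tprof_iff M _ _ _).2 ⟨trivial, ?_, h⟩⟩
    rcases h.cases_tail with h | ⟨c, _, a, u', v, q, r, hd, hh⟩
    · simp [tapeOf] at h
    · rcases hh with ⟨g1, g2, g3, g4⟩ | ⟨g1, g2, g3, g4⟩ | ⟨g1, g2, g3, g4⟩ | ⟨g1, g2, g3, g4⟩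
      · rw [(Prod.mk.inj (Prod.mk.inj g4).2).1]; exact g2
      · cases g4
      · cases g4
      · rw [(Prod.mk.inj (Prod.mk.inj g4).2).1]; exact g2
  · rintro ⟨qf, hqf, h⟩
    exact ⟨qf, hqf, ((tprof_iff M _ _ _).1 h).2.2⟩

end

/-! ### Non-crossing deterministic graphs -/

/-- Crossing of two chords, in a fixed relative position. -/
def Xing (a b c d : ℤ) : Prop :=
  min a b < min c d ∧ min c d < max a b ∧ max a b < max c d

def GDet {N : Type} (E : N → N → Prop) : Prop := ∀ u v v', E u v → E u v' → v = v'

def NCr {N : Type} (sp tp : N → ℤ) (E : N → N → Prop) : Prop :=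
  ∀ u v u' v', E u v → E u' v' → ¬ Xing (sp u) (tp v) (sp u') (tp v')

def elim {N : Type} (E : N → N → Prop) (q : N) : N → N → Prop :=
  fun u v => u ≠ q ∧ v ≠ q ∧ (E u v ∨ (E u q ∧ E q v))

theorem elim_det {N : Type} {E : N → N → Prop} (q : N) (h : GDet E) : GDet (elim E q) := by
  rintro u v v' ⟨h1, h2, h3⟩ ⟨h4, h5, h6⟩
  rcases h3 with h3 | ⟨h3, h3'⟩ <;> rcases h6 with h6 | ⟨h6, h6'⟩
  · exact h _ _ _ h3 h6
  · exact (h2 (h _ _ _ h3 h6)).elim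
  · exact (h5 (h _ _ _ h6 h3)).elim
  · exact h _ _ _ h3' h6'

theorem elim_nc {N : Type} {E : N → N → Prop} (q : N) (sp tp : N → ℤ) (h : GDet E)
    (hn : NCr sp tp E)
    (hs : ∀ u v, E u v → u ≠ q →
      sp u < min (sp q) (tp q) ∨ max (sp q) (tp q) < sp u)
    (ht : ∀ u v, E u v → v ≠ q →
      tp v < min (sp q) (tp q) ∨ max (sp q) (tp q) < tp v) :
    NCr sp tp (elim E q) := by
  rintro u v u' v' ⟨h1, h2, h3⟩ ⟨h4, h5, h6⟩
  rcases h3 with h3 | ⟨h3, h3'⟩ <;> rcases h6 with h6 | ⟨h6, h6'⟩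
  · exact hn _ _ _ _ h3 h6
  · have a1 := hs _ _ h3 h1
    have a2 := ht _ _ h3 h2
    have a3 := hs _ _ h6 h4
    have a4 := ht _ _ h6' h5
    have b1 := hn _ _ _ _ h3 h6
    have b2 := hn _ _ _ _ h6 h3
    have b3 := hn _ _ _ _ h3 h6'
    have b4 := hn _ _ _ _ h6' h3
    unfold Xing at *
    omega
  · have a1 := hs _ _ h3 h1
    have a2 := ht _ _ h3' h2
    have a3 := hs _ _ h6 h4
    have a4 := ht _ _ h6 h5
    have b1 := hn _ _ _ _ h3 h6
    have b2 := hn _ _ _ _ h6 h3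
    have b3 := hn _ _ _ _ h3' h6
    have b4 := hn _ _ _ _ h6 h3'
    unfold Xing at *
    omega
  · obtain rfl := h _ _ _ h3' h6'
    unfold Xing
    omega

theorem elim_tg {N : Type} {E : N → N → Prop} (q : N) {u v : N} (hu : u ≠ q) (hv : v ≠ q)
    (h : TransGen E u v) : TransGen (elim E q) u v := by
  have key : (u ≠ q → TransGen (elim E q) u v) ∧
      (u = q → ∃ w, w ≠ q ∧ E q w ∧ (w = v ∨ TransGen (elim E q) w v)) := by
    clear hu
    induction h using TransGen.head_induction_on with
    | single h => exact ⟨fun hu => .single ⟨hu, hv, .inl h⟩, fun e => ⟨v, hv, e ▸ h, .inl rfl⟩⟩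
    | @head a c h _ ih =>
      by_cases hc : c = q
      · obtain ⟨w, hw, h1, h2⟩ := ih.2 hc
        refine ⟨fun ha => ?_, fun _ => ⟨w, hw, h1, h2⟩⟩
        have : elim E q a w := ⟨ha, hw, .inr ⟨hc ▸ h, h1⟩⟩
        rcases h2 with rfl | h2
        · exact .single this
        · exact .head this h2
      · have h1 := ih.1 hc
        exact ⟨fun ha => .head ⟨ha, hc, .inl h⟩ h1, fun e => ⟨c, hc, e ▸ h, .inr h1⟩⟩
  exact key.1 hu

section
variable {Q : Type}

def isSrc (ρ : Q → Bool) : Q ⊕ Q → Prop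
  | .inl q => ρ q = true
  | .inr q => ρ q = false

def isTgt (ρ : Q → Bool) : Q ⊕ Q → Prop
  | .inl q => ρ q = false
  | .inr q => ρ q = true

def WF (ρ : Q → Bool) (f : Prof Q Q) : Prop := ∀ u v, f u v → isSrc ρ u ∧ isTgt ρ v

def pos (h : Q → ℤ) : Q ⊕ Q → ℤ
  | .inl q => -1 - h q
  | .inr q => h q

/-- Well-formed, deterministic and planar profiles. -/
structure Nice (ρ : Q → Bool) (h : Q → ℤ) (f : Prof Q Q) : Prop where
  wf : WF ρ f
  det : GDet f
  nc : NCr (pos h) (pos h) f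

def sp (ρ : Q → Bool) (h : Q → ℤ) (n : ℤ) : Nd Q Q Q → ℤ
  | .l q => -1 - h q
  | .m q => if ρ q then 2 * n - 1 - h q else h q
  | .r q => 2 * n + h q

def tp (ρ : Q → Bool) (h : Q → ℤ) (n : ℤ) : Nd Q Q Q → ℤ
  | .l q => -1 - h q
  | .m q => if ρ q then h q else 2 * n - 1 - h q
  | .r q => 2 * n + h q

def sOK (ρ : Q → Bool) : Nd Q Q Q → Prop
  | .l q => ρ q = true
  | .m _ => True
  | .r q => ρ q = false

def tOK (ρ : Q → Bool) : Nd Q Q Q → Prop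
  | .l q => ρ q = false
  | .m _ => True
  | .r q => ρ q = true

/-- All middle nodes touched by `E` have rank below `k`. -/
def below (h : Q → ℤ) (k : ℤ) : Nd Q Q Q → Prop
  | .m q => h q < k
  | _ => True

variable {ρ : Q → Bool} {h : Q → ℤ} {n : ℤ} {f g : Prof Q Q}

theorem CE_wf (hf : WF ρ f) (hg : WF ρ g) {u v} (e : CE f g u v) : sOK ρ u ∧ tOK ρ v := by
  rcases e with @⟨u, v, e⟩ | @⟨u, v, e⟩
  · have := hf _ _ e
    rcases u with u | u <;> rcases v with v | v <;> simp_all [isSrc, isTgt, sOK, tOK, e12]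
  · have := hg _ _ e
    rcases u with u | u <;> rcases v with v | v <;> simp_all [isSrc, isTgt, sOK, tOK, e23]

theorem CE_det (hf : WF ρ f) (hg : WF ρ g) (df : GDet f) (dg : GDet g) : GDet (CE f g) := by
  intro u v v' e e'
  rcases e with @⟨u, v, e⟩ | @⟨u, v, e⟩
  · generalize hw : (e12 u : Nd Q Q Q) = w at e'
    rcases e' with @⟨u', v', e'⟩ | @⟨u', v', e'⟩
    · have : u = u' := by
        rcases u with u | u <;> rcases u' with u' | u' <;> cases hw <;> rfl
      subst this
      rw [df _ _ _ e e']
    · exfalso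
      have h1 := (hf _ _ e).1
      have h2 := (hg _ _ e').1
      rcases u with u | u <;> rcases u' with u' | u' <;> cases hw
      simp_all [isSrc]
  · generalize hw : (e23 u : Nd Q Q Q) = w at e'
    rcases e' with @⟨u', v', e'⟩ | @⟨u', v', e'⟩
    · exfalso
      have h1 := (hg _ _ e).1
      have h2 := (hf _ _ e').1
      rcases u with u | u <;> rcases u' with u' | u' <;> cases hw
      simp_all [isSrc]
    · have : u = u' := by
        rcases u with u | u <;> rcases u' with u' | u' <;> cases hw <;> rfl
      subst this
      rw [dg _ _ _ e e']

theorem CE_nc (h0 : ∀ q, 0 ≤ h q ∧ h q < n) (hf : Nice ρ h f) (hg : Nice ρ h g) :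
    NCr (sp ρ h n) (tp ρ h n) (CE f g) := by
  have s1 : ∀ u : Q ⊕ Q, isSrc ρ u → sp ρ h n (e12 u) = pos h u := by
    rintro (u | u) hu <;> simp_all [isSrc, sp, e12, pos]
  have t1 : ∀ u : Q ⊕ Q, isTgt ρ u → tp ρ h n (e12 u) = pos h u := by
    rintro (u | u) hu <;> simp_all [isTgt, tp, e12, pos]
  have s2 : ∀ u : Q ⊕ Q, isSrc ρ u → sp ρ h n (e23 u) = 2 * n + pos h u := by
    rintro (u | u) hu <;> simp_all [isSrc, sp, e23, pos]; ring
  have t2 : ∀ u : Q ⊕ Q, isTgt ρ u → tp ρ h n (e23 u) = 2 * n + pos h u := by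
    rintro (u | u) hu <;> simp_all [isTgt, tp, e23, pos]; ring
  have b : ∀ u : Q ⊕ Q, - n ≤ pos h u ∧ pos h u < n := by
    rintro (u | u) <;> have := h0 u <;> simp only [pos] <;> omega
  intro u v u' v' e e'
  rcases e with @⟨u, v, e⟩ | @⟨u, v, e⟩ <;> rcases e' with @⟨u', v', e'⟩ | @⟨u', v', e'⟩
  · rw [s1 _ (hf.wf _ _ e).1, t1 _ (hf.wf _ _ e).2, s1 _ (hf.wf _ _ e').1, t1 _ (hf.wf _ _ e').2]
    exact hf.nc _ _ _ _ e e'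
  · rw [s1 _ (hf.wf _ _ e).1, t1 _ (hf.wf _ _ e).2, s2 _ (hg.wf _ _ e').1, t2 _ (hg.wf _ _ e').2]
    have := b u; have := b v; have := b u'; have := b v'
    unfold Xing; omega
  · rw [s2 _ (hg.wf _ _ e).1, t2 _ (hg.wf _ _ e).2, s1 _ (hf.wf _ _ e').1, t1 _ (hf.wf _ _ e').2]
    have := b u; have := b v; have := b u'; have := b v'
    unfold Xing; omega
  · rw [s2 _ (hg.wf _ _ e).1, t2 _ (hg.wf _ _ e).2, s2 _ (hg.wf _ _ e').1, t2 _ (hg.wf _ _ e').2]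
    have := hg.nc _ _ _ _ e e'
    unfold Xing at *
    omega

theorem elim_all (h0 : ∀ q, 0 ≤ h q ∧ h q < n) (hinj : Function.Injective h)
    (hf : Nice ρ h f) (hg : Nice ρ h g) (k : ℕ) :
    ∃ E : Nd Q Q Q → Nd Q Q Q → Prop,
      (∀ u v, E u v → below h (n - k) u ∧ below h (n - k) v) ∧
      (∀ u v, E u v → sOK ρ u ∧ tOK ρ v) ∧ GDet E ∧ NCr (sp ρ h n) (tp ρ h n) E ∧
      ∀ u v : Q ⊕ Q, TransGen (CE f g) (e13 u) (e13 v) → TransGen E (e13 u) (e13 v) := by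
  induction k with
  | zero =>
    refine ⟨CE f g, ?_, fun u v => CE_wf hf.wf hg.wf, CE_det hf.wf hg.wf hf.det hg.det,
      CE_nc h0 hf hg, fun _ _ h => h⟩
    intro u v _
    constructor
    · cases u <;> simp [below, h0]
    · cases v <;> simp [below, h0]
  | succ k ih =>
    obtain ⟨E, e1, e2, e3, e4, e5⟩ := ih
    by_cases hq : ∃ q, h q = n - (k + 1 : ℕ)
    · obtain ⟨q, hq⟩ := hq
      have hb : ∀ u, below h (n - k) u → u ≠ .m q → below h (n - (k + 1 : ℕ)) u := by
        rintro (u | u | u) h1 h2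
        · trivial
        · have : h u ≠ h q := fun e => h2 (by rw [hinj e])
          simp only [below] at *
          push_cast at *
          omega
        · trivial
      have hsp : ∀ u, below h (n - (k + 1 : ℕ)) u →
        (sp ρ h n u < min (sp ρ h n (.m q)) (tp ρ h n (.m q)) ∨
          max (sp ρ h n (.m q)) (tp ρ h n (.m q)) < sp ρ h n u) ∧
        (tp ρ h n u < min (sp ρ h n (.m q)) (tp ρ h n (.m q)) ∨
          max (sp ρ h n (.m q)) (tp ρ h n (.m q)) < tp ρ h n u) := by
        have hq0 := h0 q
        rintro (u | u | u) h1 <;> have hu0 := h0 u <;> simp only [below, sp, tp] at * <;>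
          split_ifs <;> omega
      refine ⟨elim E (.m q), ?_, ?_, elim_det _ e3, elim_nc _ _ _ e3 e4 ?_ ?_, ?_⟩
      · rintro u v ⟨h1, h2, h3 | ⟨h3, h3'⟩⟩
        · exact ⟨hb _ (e1 _ _ h3).1 h1, hb _ (e1 _ _ h3).2 h2⟩
        · exact ⟨hb _ (e1 _ _ h3).1 h1, hb _ (e1 _ _ h3').2 h2⟩
      · rintro u v ⟨h1, h2, h3 | ⟨h3, h3'⟩⟩
        · exact e2 _ _ h3
        · exact ⟨(e2 _ _ h3).1, (e2 _ _ h3').2⟩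
      · exact fun u v h1 h2 => (hsp u (hb _ (e1 _ _ h1).1 h2)).1
      · exact fun u v h1 h2 => (hsp v (hb _ (e1 _ _ h1).2 h2)).2
      · intro u v h1
        refine elim_tg _ ?_ ?_ (e5 u v h1)
        · cases u <;> simp [e13]
        · cases v <;> simp [e13]
    · refine ⟨E, ?_, e2, e3, e4, e5⟩
      have hb : ∀ u, below h (n - k) u → below h (n - (k + 1 : ℕ)) u := by
        rintro (u | u | u) h1
        · trivial
        · have : h u ≠ n - (k + 1 : ℕ) := fun e => hq ⟨u, e⟩
          simp only [below] at *
          push_cast at *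
          omega
        · trivial
      exact fun u v h1 => ⟨hb _ (e1 _ _ h1).1, hb _ (e1 _ _ h1).2⟩

theorem Nice.comp {N : ℕ} (h0 : ∀ q, 0 ≤ h q ∧ h q < N) (hinj : Function.Injective h)
    (hf : Nice ρ h f) (hg : Nice ρ h g) : Nice ρ h (comp f g) := by
  obtain ⟨E, e1, e2, e3, e4, e5⟩ := elim_all h0 hinj hf hg N
  have key : ∀ u v, Planar2DFT.comp f g u v → E (e13 u) (e13 v) := by
    intro u v h1
    have h2 := e5 u v h1
    obtain ⟨c, h3, h4⟩ := TransGen.head'_iff.1 h2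
    rcases h4.cases_head with rfl | ⟨d, h4, _⟩
    · exact h3
    · exfalso
      have a1 := (e2 _ _ h3).2
      have a2 := (e2 _ _ h4).1
      have a3 := (e1 _ _ h4).1
      rcases c with c | c | c
      · simp_all [sOK, tOK]
      · have := h0 c
        simp only [below] at a3
        omega
      · simp_all [sOK, tOK]
  have wf : ∀ u v, Planar2DFT.comp f g u v → isSrc ρ u ∧ isTgt ρ v := by
    intro u v h1
    have := e2 _ _ (key _ _ h1)
    rcases u with u | u <;> rcases v with v | v <;> exact this
  refine ⟨wf, ?_, ?_⟩
  · intro u v v' h1 h2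
    have := e3 _ _ _ (key _ _ h1) (key _ _ h2)
    rcases v with v | v <;> rcases v' with v' | v' <;> cases this <;> rfl
  · intro u v u' v' h1 h2
    have := e4 _ _ _ _ (key _ _ h1) (key _ _ h2)
    have b := h0
    rcases u with u | u <;> rcases v with v | v <;> rcases u' with u' | u' <;>
      rcases v' with v' | v' <;> have b1 := h0 u <;> have b2 := h0 v <;> have b3 := h0 u' <;>
      have b4 := h0 v' <;> simp only [e13, sp, tp, pos, Xing] at * <;> omega

end

theorem mono_surj_id {I : Type} [Finite I] (k : I → ℤ) (hk : Function.Injective k) (σ : I → I)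
    (hs : Function.Surjective σ) (hm : ∀ a b, k a ≤ k b → k (σ a) ≤ k (σ b)) : ∀ a, σ a = a := by
  let _ : LinearOrder I := LinearOrder.lift' k hk
  have hinj : Function.Injective σ := Finite.injective_iff_surjective.2 hs
  have hmono : Monotone σ := fun a b hab => hm a b hab
  have hsm : StrictMono σ := hmono.strictMono_of_injective hinj
  intro a
  exact le_antisymm hsm.apply_le hsm.le_apply

theorem stab_mono {α : Type} [PartialOrder α] [Finite α] (s : ℕ → α) (hs : ∀ n, s n ≤ s (n + 1)) :
    ∃ N, ∀ n, N ≤ n → s (n + 1) = s n := by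
  obtain ⟨N, hN⟩ := WellFoundedGT.monotone_chain_condition ⟨s, monotone_nat_of_le_succ hs⟩
  refine ⟨N, fun n hn => ?_⟩
  have h1 := hN n hn
  have h2 := hN (n + 1) (by omega)
  exact h2.symm.trans h1

theorem stab_anti {α : Type} [PartialOrder α] [Finite α] (s : ℕ → α) (hs : ∀ n, s (n + 1) ≤ s n) :
    ∃ N, ∀ n, N ≤ n → s (n + 1) = s n :=
  stab_mono (α := αᵒᵈ) s hs

theorem det_sink {N : Type} {E : N → N → Prop} (hE : GDet E) {u v v' : N}
    (hv : ∀ w, ¬ E v w) (hv' : ∀ w, ¬ E v' w) (h : ReflTransGen E u v) (h' : ReflTransGen E u v') :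
    v = v' := by
  induction h using ReflTransGen.head_induction_on with
  | refl =>
    rcases h'.cases_head with h | ⟨c, h, _⟩
    · exact h
    · exact (hv _ h).elim
  | head h1 _ ih =>
    rcases h'.cases_head with h | ⟨c, h, h2⟩
    · subst h
      exact (hv' _ h1).elim
    · obtain rfl := hE _ _ _ h1 h
      exact ih h2

section
variable {Q : Type}

/-- `pw f n` is the `n+1`-st power. -/
def pw (f : Prof Q Q) : ℕ → Prof Q Q
  | 0 => f
  | n + 1 => comp (pw f n) f

theorem pw_succ' (f : Prof Q Q) (n : ℕ) : pw f (n + 1) = comp f (pw f n) := by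
  induction n with
  | zero => rfl
  | succ n ih =>
    change comp (pw f (n + 1)) f = comp f (comp (pw f n) f)
    rw [ih, comp_assoc]

variable {ρ : Q → Bool} {h : Q → ℤ} {f : Prof Q Q} {N : ℕ}

theorem Nice.pw (h0 : ∀ q, 0 ≤ h q ∧ h q < N) (hinj : Function.Injective h)
    (hf : Nice ρ h f) (n : ℕ) : Nice ρ h (pw f n) := by
  induction n with
  | zero => exact hf
  | succ n ih => exact ih.comp h0 hinj hf

theorem pw_RR (f : Prof Q Q) (n : ℕ) (q r : Q) (e : pw f n (.inr q) (.inr r)) :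
    pw f (n + 1) (.inr q) (.inr r) := by
  rw [pw_succ']
  exact .single (CE.right e)

/-- The graph describing what happens after a strand has left the left block. -/
inductive PsiE (B : Q → Q → Prop) (f : Prof Q Q) : Q ⊕ Q → Q ⊕ Q → Prop
  | b {q r} : B q r → PsiE B f (.inl q) (.inl r)
  | f {u v} : f u v → PsiE B f u v

theorem lr_step {f g : Prof Q Q} (hf : WF ρ f) (hg : WF ρ g) (q r : Q) :
    comp g f (.inl q) (.inr r) ↔
      ∃ m, g (.inl q) (.inr m) ∧
        TransGen (PsiE (fun a b => g (.inr a) (.inr b)) f) (.inl m) (.inr r) := by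
  constructor
  · intro hc
    obtain ⟨c, h1, h2⟩ := TransGen.head'_iff.1 hc
    have h1' : ∃ m, g (.inl q) (.inr m) ∧ c = .m m := by
      generalize hs : (e13 (.inl q) : Nd Q Q Q) = s at h1
      rcases h1 with @⟨u, v, e⟩ | @⟨u, v, e⟩
      · rcases u with u | u <;> cases hs
        rcases v with v | v
        · exfalso
          rcases h2.cases_head with h3 | ⟨d, h3, _⟩
          · cases h3
          · have a1 := (hg _ _ e).2
            have a2 := (CE_wf hg hf h3).1
            simp_all [isTgt, sOK, e12]
        · exact ⟨v, e, rfl⟩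
      · rcases u with u | u <;> cases hs
    obtain ⟨m, h3, rfl⟩ := h1'
    refine ⟨m, h3, ?_⟩
    have key : ∀ d, ReflTransGen (CE g f) (.m m) d → (∃ w : Q, d = .l w ∧ ρ w = false) ∨
        ∃ w : Q ⊕ Q, d = e23 w ∧
          ReflTransGen (PsiE (fun a b => g (.inr a) (.inr b)) f) (.inl m) w := by
      intro d hd
      induction hd with
      | refl => exact .inr ⟨.inl m, rfl, .refl⟩
      | @tail c d _ e ih =>
        rcases ih with ⟨w, rfl, hw⟩ | ⟨w, rfl, hw⟩
        · have a2 := (CE_wf hg hf e).1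
          simp [sOK, hw] at a2
        · generalize hs : (e23 w : Nd Q Q Q) = s at e
          rcases e with @⟨u, v, e⟩ | @⟨u, v, e⟩
          · rcases u with u | u <;> rcases w with w | w <;> cases hs
            rcases v with v | v
            · exact .inl ⟨v, rfl, (hg _ _ e).2⟩
            · exact .inr ⟨.inl v, rfl, hw.tail (.b e)⟩
          · have : w = u := by
              rcases u with u | u <;> rcases w with w | w <;> cases hs <;> rfl
            subst this
            exact .inr ⟨v, rfl, hw.tail (.f e)⟩
    rcases key _ h2 with ⟨w, h4, _⟩ | ⟨w, h4, h5⟩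
    · cases h4
    · have : w = .inr r := by
        rcases w with w | w <;> cases h4; rfl
      subst this
      rcases reflTransGen_iff_eq_or_transGen.1 h5 with h6 | h6
      · cases h6
      · exact h6
  · rintro ⟨m, h1, h2⟩
    refine TransGen.head (CE.left h1) ?_
    refine tg_lift' (p := CE g f) e23 ?_ h2
    rintro _ _ (e | e)
    · exact .single (CE.left e)
    · exact .single (CE.right e)

theorem lr_img {f g : Prof Q Q} (hf : WF ρ f) (hg : WF ρ g) (q r : Q)
    (hc : comp f g (.inl q) (.inr r)) : ∃ m, g (.inl m) (.inr r) := by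
  obtain ⟨c, h1, h2⟩ := TransGen.tail'_iff.1 hc
  generalize hs : (e13 (.inr r) : Nd Q Q Q) = s at h2
  rcases h2 with @⟨u, v, e⟩ | @⟨u, v, e⟩
  · rcases v with v | v <;> cases hs
  · rcases v with v | v <;> cases hs
    rcases u with u | u
    · exact ⟨u, e⟩
    · exfalso
      rcases h1.cases_tail with h3 | ⟨d, _, h3⟩
      · cases h3
      · have a1 := (hg _ _ e).1
        have a2 := (CE_wf hf hg h3).2
        simp_all [isSrc, tOK, e23]

theorem lr_stab [Finite Q] (h0 : ∀ q, 0 ≤ h q ∧ h q < N) (hinj : Function.Injective h)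
    (hf : Nice ρ h f) : ∃ K, ∀ n, K ≤ n → ∀ q r, pw f (n + 1) (.inl q) (.inr r) ↔
      pw f n (.inl q) (.inr r) := by
  have np := hf.pw h0 hinj
  obtain ⟨K2, hK2⟩ := stab_anti (fun n => {q : Q | ∃ r, pw f n (.inl q) (.inr r)})
    (fun n q hq => by
      obtain ⟨r, hr⟩ := hq
      obtain ⟨m, hm, _⟩ := (lr_step hf.wf (np n).wf q r).1 hr
      exact ⟨m, hm⟩)
  obtain ⟨K3, hK3⟩ := stab_anti (fun n => {r : Q | ∃ q, pw f n (.inl q) (.inr r)})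
    (fun n r hr => by
      obtain ⟨q, hr⟩ := hr
      rw [pw_succ'] at hr
      exact lr_img hf.wf (np n).wf q r hr)
  refine ⟨max K2 K3, fun n hn => ?_⟩
  have hd := hK2 n (by omega)
  have hi := hK3 n (by omega)
  -- the map on the image
  set I := {r : Q // ∃ q, pw f n (.inl q) (.inr r)} with hI
  have ex : ∀ m : I, ∃ r : I, ∃ q, pw f n (.inl q) (.inr m.1) ∧ pw f (n + 1) (.inl q) (.inr r.1) := by
    rintro ⟨m, q, hq⟩
    have : q ∈ {q : Q | ∃ r, pw f (n + 1) (.inl q) (.inr r)} := by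
      rw [hd]; exact ⟨m, hq⟩
    obtain ⟨r, hr⟩ := this
    have hr' : r ∈ {r : Q | ∃ q, pw f n (.inl q) (.inr r)} := by
      rw [← hi]; exact ⟨q, hr⟩
    exact ⟨⟨r, hr'⟩, q, hq, hr⟩
  choose σ q hq1 hq2 using ex
  -- functional dependency through the middle
  have func : ∀ q q' m r r', pw f n (.inl q) (.inr m) → pw f n (.inl q') (.inr m) →
      pw f (n + 1) (.inl q) (.inr r) → pw f (n + 1) (.inl q') (.inr r') → r = r' := by
    intro q q' m r r' a1 a2 a3 a4
    obtain ⟨m1, b1, b2⟩ := (lr_step hf.wf (np n).wf q r).1 a3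
    obtain ⟨m2, b3, b4⟩ := (lr_step hf.wf (np n).wf q' r').1 a4
    cases (np n).det _ _ _ a1 b1
    cases (np n).det _ _ _ a2 b3
    have hrho := ((np (n + 1)).wf _ _ a3).2
    have hrho' := ((np (n + 1)).wf _ _ a4).2
    have detP : GDet (PsiE (fun a b => pw f n (.inr a) (.inr b)) f) := by
      rintro _ _ _ (e | e) e'
      · generalize hs : (Sum.inl _ : Q ⊕ Q) = s at e'
        rcases e' with e' | e'
        · cases hs
          cases (np n).det _ _ _ e e'
          rfl
        · subst hs
          have := (hf.wf _ _ e').1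
          have := ((np n).wf _ _ e).1
          simp_all [isSrc]
      · rcases e' with e' | e'
        · have := (hf.wf _ _ e).1
          have := ((np n).wf _ _ e').1
          simp_all [isSrc]
        · exact hf.det _ _ _ e e'
    have sink : ∀ r, ρ r = true → ∀ w, ¬ PsiE (fun a b => pw f n (.inr a) (.inr b)) f (.inr r) w := by
      intro r hr w e
      rcases e with e | e
      have := (hf.wf _ _ e).1
      simp [isSrc, hr] at this
    have := det_sink detP (sink _ hrho) (sink _ hrho') b2.to_reflTransGen b4.to_reflTransGen
    cases this; rfl
  have surj : Function.Surjective σ := by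
    rintro ⟨r, hr⟩
    have hr' : r ∈ {r : Q | ∃ q, pw f (n + 1) (.inl q) (.inr r)} := by
      rw [hi]; exact hr
    obtain ⟨q', hq'⟩ := hr'
    obtain ⟨m, hm, _⟩ := (lr_step hf.wf (np n).wf q' r).1 hq'
    refine ⟨⟨m, q', hm⟩, Subtype.ext ?_⟩
    exact func _ _ m _ _ (hq1 ⟨m, q', hm⟩) hm (hq2 ⟨m, q', hm⟩) hq'
  have mono : ∀ a b : I, h a.1 ≤ h b.1 → h (σ a).1 ≤ h (σ b).1 := by
    intro a b hab
    by_contra hlt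
    have c1 := (np n).nc _ _ _ _ (hq1 a) (hq1 b)
    have c2 := (np n).nc _ _ _ _ (hq1 b) (hq1 a)
    have c3 := (np (n + 1)).nc _ _ _ _ (hq2 a) (hq2 b)
    have c4 := (np (n + 1)).nc _ _ _ _ (hq2 b) (hq2 a)
    have b1 := h0 (q a)
    have b2 := h0 (q b)
    have b3 := h0 a.1
    have b4 := h0 b.1
    have b5 := h0 (σ a).1
    have b6 := h0 (σ b).1
    have d1 : h a.1 = h b.1 → h (σ a).1 = h (σ b).1 := by
      intro e
      have : a = b := Subtype.ext (hinj e)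
      rw [this]
    have d2 : h (q a) = h (q b) → h (σ a).1 = h (σ b).1 := by
      intro e
      have e := hinj e
      have := hq2 a
      rw [e] at this
      rw [Sum.inr.inj ((np (n + 1)).det _ _ _ this (hq2 b))]
    simp only [pos, Xing] at c1 c2 c3 c4
    omega
  have hid := mono_surj_id (fun a : I => h a.1) (fun a b e => Subtype.ext (hinj e)) σ surj mono
  intro q' r
  constructor
  · intro e
    obtain ⟨m, hm, _⟩ := (lr_step hf.wf (np n).wf q' r).1 e
    have e1 := func _ _ m _ _ (hq1 ⟨m, q', hm⟩) hm (hq2 ⟨m, q', hm⟩) e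
    rw [hid] at e1
    subst e1
    exact hm
  · intro e
    have : q' ∈ {q : Q | ∃ r, pw f (n + 1) (.inl q) (.inr r)} := by
      rw [hd]; exact ⟨r, e⟩
    obtain ⟨r', hr'⟩ := this
    have e1 := func _ _ r _ _ (hq1 ⟨r, q', e⟩) e (hq2 ⟨r, q', e⟩) hr'
    rw [hid] at e1
    change r = r' at e1
    rw [e1]
    exact hr'

/-! mirror -/

def mir (f : Prof Q Q) : Prof Q Q := fun u v => f u.swap v.swap

def nswap : Nd Q Q Q → Nd Q Q Q
  | .l q => .r q
  | .m q => .m q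
  | .r q => .l q

theorem comp_mir_aux (f g : Prof Q Q) (u v : Nd Q Q Q) (e : CE (mir g) (mir f) u v) :
    CE f g (nswap u) (nswap v) := by
  rcases e with @⟨u, v, e⟩ | @⟨u, v, e⟩
  · have : ∀ u : Q ⊕ Q, nswap (e12 u) = e23 u.swap := by rintro (u | u) <;> rfl
    rw [this, this]; exact .right e
  · have : ∀ u : Q ⊕ Q, nswap (e23 u) = e12 u.swap := by rintro (u | u) <;> rfl
    rw [this, this]; exact .left e

theorem comp_mir_le (f g : Prof Q Q) (u v : Q ⊕ Q) (e : comp (mir g) (mir f) u v) :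
    mir (comp f g) u v := by
  have h1 : ∀ u : Q ⊕ Q, (e13 u.swap : Nd Q Q Q) = nswap (e13 u) := by rintro (u | u) <;> rfl
  unfold mir comp
  rw [h1, h1]
  exact tg_lift' nswap (fun a b e => .single (comp_mir_aux f g a b e)) e

theorem mir_mir (f : Prof Q Q) : mir (mir f) = f := by
  funext u v; simp [mir]

theorem comp_mir (f g : Prof Q Q) : comp (mir g) (mir f) = mir (comp f g) := by
  funext u v
  apply propext
  refine ⟨comp_mir_le f g u v, fun e => ?_⟩
  have := comp_mir_le (mir g) (mir f) u.swap v.swap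
  rw [mir_mir, mir_mir] at this
  have := this e
  simpa [mir] using this

theorem pw_mir (f : Prof Q Q) (n : ℕ) : pw (mir f) n = mir (pw f n) := by
  induction n with
  | zero => rfl
  | succ n ih =>
    rw [pw_succ' f]
    change comp (pw (mir f) n) (mir f) = _
    rw [ih, comp_mir]

theorem Nice.mir (hf : Nice ρ h f) : Nice (fun q => !ρ q) h (mir f) := by
  refine ⟨?_, ?_, ?_⟩
  · intro u v e
    have := hf.wf _ _ e
    rcases u with u | u <;> rcases v with v | v <;> simpa [isSrc, isTgt] using this
  · intro u v v' e e'
    exact Sum.swap_leftInverse.injective (hf.det _ _ _ e e')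
  · have hp : ∀ u : Q ⊕ Q, pos h u.swap = -1 - pos h u := by
      rintro (u | u) <;> simp [pos]
    intro u v u' v' e e'
    have c1 := hf.nc _ _ _ _ e e'
    have c2 := hf.nc _ _ _ _ e' e
    simp only [hp, Xing] at *
    omega

theorem pw_stab [Finite Q] (h0 : ∀ q, 0 ≤ h q ∧ h q < N) (hinj : Function.Injective h)
    (hf : Nice ρ h f) : ∃ n, pw f (n + 1) = pw f n := by
  obtain ⟨K1, hK1⟩ := lr_stab h0 hinj hf
  obtain ⟨K2, hK2⟩ := lr_stab h0 hinj hf.mir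
  obtain ⟨K3, hK3⟩ := stab_mono (fun n => fun q r : Q => pw f n (.inr q) (.inr r))
    (fun n q r => pw_RR f n q r)
  obtain ⟨K4, hK4⟩ := stab_mono (fun n => fun q r : Q => pw (mir f) n (.inr q) (.inr r))
    (fun n q r => pw_RR (mir f) n q r)
  let n := max (max K1 K2) (max K3 K4)
  refine ⟨n, ?_⟩
  funext u v
  apply propext
  rcases u with u | u <;> rcases v with v | v
  · have := congrFun (congrFun (hK4 n (by omega)) u) v
    simp only [pw_mir, mir, Sum.swap_inr] at this
    rw [this]
  · exact hK1 n (by omega) u v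
  · have := hK2 n (by omega) u v
    simpa only [pw_mir, mir, Sum.swap_inr, Sum.swap_inl] using this
  · have := congrFun (congrFun (hK3 n (by omega)) u) v
    exact iff_of_eq this

end

section
variable {Q : Type}

theorem exists_rank [Finite Q] (lt : Q → Q → Prop) (hlt : IsStrictTotalOrder Q lt) :
    ∃ (N : ℕ) (h : Q → ℤ), (∀ q, 0 ≤ h q ∧ h q < N) ∧ Function.Injective h ∧
      ∀ a b, lt a b ↔ h a < h b := by
  classical
  have := Fintype.ofFinite Q
  let c : Q → ℕ := fun q => (Finset.univ.filter (fun p => lt p q)).card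
  have hc : ∀ a b, lt a b → c a < c b := by
    intro a b hab
    apply Finset.card_lt_card
    refine ⟨fun x hx => ?_, fun hs => ?_⟩
    · simp only [Finset.mem_filter, Finset.mem_univ, true_and] at *
      exact hlt.trans _ _ _ hx hab
    · have : a ∈ Finset.univ.filter (fun p => lt p a) := hs (by simpa using hab)
      simp only [Finset.mem_filter, Finset.mem_univ, true_and] at this
      exact hlt.irrefl _ this
  have tri : ∀ a b, lt a b ∨ a = b ∨ lt b a := by
    intro a b
    by_cases h1 : lt a b
    · exact .inl h1
    · by_cases h2 : lt b a
      · exact .inr (.inr h2)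
      · exact .inr (.inl (hlt.trichotomous a b h1 h2))
  refine ⟨Fintype.card Q, fun q => c q, fun q => ⟨by positivity, ?_⟩, ?_, ?_⟩
  · have : c q < Fintype.card Q := by
      apply Finset.card_lt_univ_of_notMem (x := q)
      simp only [Finset.mem_filter, Finset.mem_univ, true_and]
      exact hlt.irrefl _
    exact Int.ofNat_lt.2 this
  · intro a b hab
    have hab : c a = c b := Int.ofNat_inj.1 hab
    rcases tri a b with h | h | h
    · have := hc _ _ h; omega
    · exact h
    · have := hc _ _ h; omega
  · intro a b
    constructor
    · intro h
      have := hc _ _ h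
      exact Int.ofNat_lt.2 this
    · intro h
      have h : c a < c b := Int.ofNat_lt.1 h
      rcases tri a b with h1 | h1 | h1
      · exact h1
      · subst h1; omega
      · have := hc _ _ h1; omega

def vpos (h : Q → ℤ) (x : Q × Bool) : ℤ := if x.2 then h x.1 else -1 - h x.1

theorem extLt_iff {lt : Q → Q → Prop} {h : Q → ℤ} (h0 : ∀ q, 0 ≤ h q)
    (hl : ∀ a b, lt a b ↔ h a < h b) (x y : Q × Bool) :
    ExtLt lt x y ↔ vpos h x < vpos h y := by
  rcases x with ⟨x, bx⟩
  rcases y with ⟨y, b⟩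
  have h1 := h0 x
  have h2 := h0 y
  cases bx <;> cases b <;> simp [ExtLt, vpos, hl]
  · omega
  · omega

theorem prof_nice {ρ : Q → Bool} {lt : Q → Q → Prop} {h : Q → ℤ} (h0 : ∀ q, 0 ≤ h q)
    (hl : ∀ a b, lt a b ↔ h a < h b) {f : Set (Q × Q)} (hd : IsDet f) (hp : IsPlanar ρ lt f) :
    Nice ρ h (prof ρ f) := by
  refine ⟨?_, ?_, ?_⟩
  · rintro _ _ @⟨q, r, e⟩
    constructor
    · cases hq : ρ q
      · rw [srcN_f hq]; exact hq
      · rw [srcN_t hq]; exact hq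
    · cases hq : ρ r
      · rw [tgtN_f hq]; exact hq
      · rw [tgtN_t hq]; exact hq
  · rintro _ v v' @⟨q, r, e⟩ e'
    generalize hs : srcN ρ q = s at e'
    obtain @⟨q', r', e'⟩ := e'
    have : q = q' := by
      unfold srcN at hs
      split_ifs at hs <;> cases hs <;> rfl
    subst this
    rw [hd _ _ _ e e']
  · rintro _ _ _ _ @⟨q, r, e⟩ @⟨q', r', e'⟩ hx
    have s1 : ∀ q, pos h (srcN ρ q) = vpos h (q, !ρ q) := by
      intro q; cases hq : ρ q <;> simp [srcN, hq, pos, vpos]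
    have t1 : ∀ q, pos h (tgtN ρ q) = vpos h (q, ρ q) := by
      intro q; cases hq : ρ q <;> simp [tgtN, hq, pos, vpos]
    rw [s1, t1, s1, t1] at hx
    have E1 : ProfileEdge ρ f (q, !ρ q) (r, ρ r) := ⟨_, e, rfl, rfl⟩
    have E2 : ProfileEdge ρ f (q', !ρ q') (r', ρ r') := ⟨_, e', rfl, rfl⟩
    apply hp
    generalize (q, !ρ q) = a at *
    generalize (r, ρ r) = b at *
    generalize (q', !ρ q') = c at *
    generalize (r', ρ r') = d at *
    simp only [extLt_iff h0 hl]
    unfold Xing at hx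
    rcases le_total (vpos h a) (vpos h b) with o1 | o1 <;>
      rcases le_total (vpos h c) (vpos h d) with o2 | o2
    · exact ⟨a, c, b, d, by omega, by omega, by omega, .inl E1, .inl E2⟩
    · exact ⟨a, d, b, c, by omega, by omega, by omega, .inl E1, .inr E2⟩
    · exact ⟨b, c, a, d, by omega, by omega, by omega, .inr E1, .inl E2⟩
    · exact ⟨b, d, a, c, by omega, by omega, by omega, .inr E1, .inr E2⟩

open MulOpposite in
theorem starFree_of_planar {A : Type} [Finite A] [Finite Q] (M : TwoWayAutomaton Q A)
    (hp : M.Planar) (hd : M.Deterministic) : StarFree M.Language := by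
  obtain ⟨lt, hlt, hp⟩ := hp
  obtain ⟨N, h, h0, hinj, hl⟩ := exists_rank lt hlt
  have np : ∀ a : A, Nice M.ρ h (prof M.ρ (M.δ (.sym a))) :=
    fun a => prof_nice (fun q => (h0 q).1) hl (hd _) (hp a)
  let X := Prof Unit Q
  let g : A → (Function.End X)ᵐᵒᵖ := fun a => op (fun x : X => comp x (prof M.ρ (M.δ (.sym a))))
  let S : Submonoid (Function.End X)ᵐᵒᵖ := Submonoid.closure (Set.range g)
  have hS : ∀ m ∈ S, m = 1 ∨ ∃ b : Prof Q Q, Nice M.ρ h b ∧ ∀ x : X, (unop m) x = comp x b := by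
    intro m hm
    induction hm using Submonoid.closure_induction with
    | mem x hx =>
      obtain ⟨a, rfl⟩ := hx
      exact .inr ⟨_, np a, fun x => rfl⟩
    | one => exact .inl rfl
    | mul x₀ y _ _ hx hy =>
      rcases hx with rfl | ⟨b, hb, hx⟩
      · rw [one_mul]; exact hy
      · rcases hy with rfl | ⟨c, hc, hy⟩
        · rw [mul_one]; exact .inr ⟨b, hb, hx⟩
        · refine .inr ⟨comp b c, hb.comp h0 hinj hc, fun x => ?_⟩
          change (unop y) ((unop x₀) x) = _
          rw [hx, hy, comp_assoc]
  have hfin : Finite X := by infer_instance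
  have hfin2 : Finite (Function.End X) := by unfold Function.End; infer_instance
  have hfin3 : Finite (Function.End X)ᵐᵒᵖ := Finite.of_equiv _ opEquiv
  have hap : Aper S := by
    rintro ⟨m, hm⟩
    rcases hS m hm with rfl | ⟨b, hb, hx⟩
    · exact ⟨0, Subtype.ext (by simp)⟩
    · obtain ⟨n, hn⟩ := pw_stab h0 hinj hb
      have hpw : ∀ k (x : X), (unop (m ^ (k + 1))) x = comp x (pw b k) := by
        intro k
        induction k with
        | zero => intro x; rw [zero_add, pow_one]; exact hx x
        | succ k ih =>
          intro x
          rw [pow_succ m (k + 1)]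
          change (unop m) (unop (m ^ (k + 1)) x) = _
          rw [ih, hx, comp_assoc]
          rfl
      refine ⟨n + 1, Subtype.ext ?_⟩
      apply unop_injective
      funext x
      change (unop (m ^ (n + 1 + 1))) x = (unop (m ^ (n + 1))) x
      rw [hpw, hpw, hn]
  let g' : A → S := fun a => ⟨g a, Submonoid.subset_closure ⟨a, rfl⟩⟩
  have hprod : ∀ (w : List A) (x : X), (unop ((w.map g').prod : S).1) x =
      w.foldl (fun x a => comp x (prof M.ρ (M.δ (.sym a)))) x := by
    intro w
    induction w with
    | nil => intro x; rfl
    | cons a w ih =>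
      intro x
      rw [List.map_cons, List.prod_cons, List.foldl_cons, ← ih]
      rfl
  let x1 : X := comp (startP M.init) (prof M.ρ (M.δ .lend))
  have := class_of_monoid starFree_class hap g'
    (fun m => ∃ qf ∈ M.final, comp ((unop m.1) x1) (prof M.ρ (M.δ .rend)) (.inl ()) (.inr qf))
  convert this using 1
  ext w
  change M.Accepts w ↔ _
  rw [accepts_iff]
  change _ ↔ ∃ qf ∈ M.final, comp ((unop ((w.map g').prod : S).1) x1) _ _ _
  rw [hprod]
  simp only [tapeOf, tprof, List.foldl_cons, List.foldl_append, List.foldl_map, List.foldl_nil]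
  rfl

end

section
variable {Q : Type}

def ps (ρ : Q → Bool) (h : Q → ℤ) (q : Q) : ℤ := if ρ q then -1 - h q else h q
def pt (ρ : Q → Bool) (h : Q → ℤ) (q : Q) : ℤ := if ρ q then h q else -1 - h q

def NCf (ρ : Q → Bool) (h : Q → ℤ) (f : Set (Q × Q)) : Prop :=
  ∀ q r q' r', (q, r) ∈ f → (q', r') ∈ f →
    ¬ Xing (ps ρ h q) (pt ρ h r) (ps ρ h q') (pt ρ h r')

theorem ps_eq (ρ : Q → Bool) (h : Q → ℤ) (q : Q) : ps ρ h q = vpos h (q, !ρ q) := by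
  cases hq : ρ q <;> simp [ps, vpos, hq]
theorem pt_eq (ρ : Q → Bool) (h : Q → ℤ) (q : Q) : pt ρ h q = vpos h (q, ρ q) := by
  cases hq : ρ q <;> simp [pt, vpos, hq]

theorem NCf_of_planar {ρ : Q → Bool} {lt : Q → Q → Prop} {h : Q → ℤ} (h0 : ∀ q, 0 ≤ h q)
    (hl : ∀ a b, lt a b ↔ h a < h b) {f : Set (Q × Q)} (hp : IsPlanar ρ lt f) :
    NCf ρ h f := by
  intro q r q' r' e e' hx
  rw [ps_eq, pt_eq, ps_eq, pt_eq] at hx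
  have E1 : ProfileEdge ρ f (q, !ρ q) (r, ρ r) := ⟨_, e, rfl, rfl⟩
  have E2 : ProfileEdge ρ f (q', !ρ q') (r', ρ r') := ⟨_, e', rfl, rfl⟩
  apply hp
  generalize (q, !ρ q) = a at *
  generalize (r, ρ r) = b at *
  generalize (q', !ρ q') = c at *
  generalize (r', ρ r') = d at *
  simp only [extLt_iff h0 hl]
  unfold Xing at hx
  rcases le_total (vpos h a) (vpos h b) with o1 | o1 <;>
    rcases le_total (vpos h c) (vpos h d) with o2 | o2
  · exact ⟨a, c, b, d, by omega, by omega, by omega, .inl E1, .inl E2⟩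
  · exact ⟨a, d, b, c, by omega, by omega, by omega, .inl E1, .inr E2⟩
  · exact ⟨b, c, a, d, by omega, by omega, by omega, .inr E1, .inl E2⟩
  · exact ⟨b, d, a, c, by omega, by omega, by omega, .inr E1, .inr E2⟩

theorem planar_of_NCf {ρ : Q → Bool} {h : Q → ℤ} (h0 : ∀ q, 0 ≤ h q)
    {f : Set (Q × Q)} (hp : NCf ρ h f) : IsPlanar ρ (fun a b => h a < h b) f := by
  rintro ⟨u, r, v, s, h1, h2, h3, h4, h5⟩
  rw [extLt_iff h0 (fun _ _ => Iff.rfl)] at h1 h2 h3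
  rcases h4 with ⟨⟨p, p'⟩, e, rfl, rfl⟩ | ⟨⟨p, p'⟩, e, rfl, rfl⟩ <;>
    rcases h5 with ⟨⟨t, t'⟩, e', rfl, rfl⟩ | ⟨⟨t, t'⟩, e', rfl, rfl⟩ <;>
    have := hp _ _ _ _ e e' <;>
    rw [ps_eq, pt_eq, ps_eq, pt_eq] at this <;>
    simp only [Xing] at * <;> omega

theorem planar_intro {A : Type} {M : TwoWayAutomaton Q A} (h : Q → ℤ) (h0 : ∀ q, 0 ≤ h q)
    (hinj : Function.Injective h) (hp : ∀ a, NCf M.ρ h (M.δ (.sym a))) : M.Planar := by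
  refine ⟨fun a b => h a < h b, ?_, fun a => planar_of_NCf h0 (hp a)⟩
  exact
    { trichotomous := fun a b h1 h2 => hinj (by omega)
      irrefl := fun a => lt_irrefl _
      trans := fun a b c => lt_trans }

/-- States of the machine simulating a machine after a flip-flop. -/
inductive St (V Q : Type) where
  | s : V → Q → St V Q
  | u : V → Q → St V Q
  | w : Q → St V Q

variable {V : Type}

instance [Finite V] [Finite Q] : Finite (St V Q) := by
  let F : (V × Q) ⊕ (V × Q) ⊕ Q → St V Q
    | .inl p => .s p.1 p.2
    | .inr (.inl p) => .u p.1 p.2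
    | .inr (.inr q) => .w q
  apply Finite.of_surjective F
  rintro (⟨v, q⟩ | ⟨v, q⟩ | q)
  · exact ⟨.inl (v, q), rfl⟩
  · exact ⟨.inr (.inl (v, q)), rfl⟩
  · exact ⟨.inr (.inr q), rfl⟩

def Sρ (ρ : Q → Bool) : St V Q → Bool
  | .s _ q => ρ q
  | .u _ q => !ρ q
  | .w q => ρ q

/-- keep -/
inductive DK (D : V → Set (Q × Q)) : St V Q → St V Q → Prop
  | s {v q r} : (q, r) ∈ D v → DK D (.s v q) (.s v r)
  | u {v q} : DK D (.u v q) (.u v q)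
  | w {q} : DK D (.w q) (.w q)

/-- set to `x` -/
inductive DS (ρ : Q → Bool) (D : V → Set (Q × Q)) (x : V) : St V Q → St V Q → Prop
  | ff {v q r} : (q, r) ∈ D v → ρ q = true → ρ r = true → DS ρ D x (.s v q) (.u v r)
  | fb {v q r} : (q, r) ∈ D v → ρ q = true → ρ r = false → DS ρ D x (.s v q) (.s v r)
  | bf {v q r} : (q, r) ∈ D v → ρ q = false → ρ r = true → DS ρ D x (.u v q) (.u v r)
  | bb {v q r} : (q, r) ∈ D v → ρ q = false → ρ r = false → DS ρ D x (.u v q) (.s v r)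
  | uw {q} : ρ q = true → DS ρ D x (.u x q) (.w q)
  | ws {q} : ρ q = true → DS ρ D x (.w q) (.s x q)
  | wu {q} : ρ q = false → DS ρ D x (.w q) (.u x q)
  | sw {q} : ρ q = false → DS ρ D x (.s x q) (.w q)

/-- left end -/
inductive DL (ρ : Q → Bool) (D : Set (Q × Q)) (x : V) : St V Q → St V Q → Prop
  | s {q r} : (q, r) ∈ D → DL ρ D x (.s x q) (.s x r)
  | uw {q} : ρ q = true → DL ρ D x (.u x q) (.w q)
  | wu {q} : ρ q = false → DL ρ D x (.w q) (.u x q)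

def ffδ {A B : Type} (M : TwoWayAutomaton Q B) (u : A → Option V) (o : V → A → B) (v0 : V) :
    Tape A → Set (St V Q × St V Q)
  | .lend => {p | DL M.ρ (M.δ .lend) v0 p.1 p.2}
  | .rend => {p | DK (fun _ => M.δ .rend) p.1 p.2}
  | .sym a =>
    match u a with
    | none => {p | DK (fun v => M.δ (.sym (o v a))) p.1 p.2}
    | some x => {p | DS M.ρ (fun v => M.δ (.sym (o v a))) x p.1 p.2}

def ffM {A B : Type} (M : TwoWayAutomaton Q B) (u : A → Option V) (o : V → A → B) (v0 : V) :
    TwoWayAutomaton (St V Q) A where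
  ρ := Sρ M.ρ
  init := .s v0 M.init
  init_fwd := M.init_fwd
  final := {p | ∃ v q, q ∈ M.final ∧ p = .s v q}
  δ := ffδ M u o v0

theorem DK_rev {D : V → Set (Q × Q)} (hD : ∀ v, IsRev (D v)) :
    IsRev {p : St V Q × St V Q | DK D p.1 p.2} := by
  constructor
  · intro p r r' h1 h2
    change DK D _ _ at h1
    change DK D _ _ at h2
    cases h1 <;> cases h2
    · rename_i a _ b
      rw [(hD _).1 _ _ _ a b]
    · rfl
    · rfl
  · intro p r r' h1 h2
    change DK D _ _ at h1
    change DK D _ _ at h2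
    cases h1 <;> cases h2
    · rename_i a _ b
      rw [(hD _).2 _ _ _ a b]
    · rfl
    · rfl

theorem DL_rev {ρ : Q → Bool} {D : Set (Q × Q)} {x : V} (hD : IsRev D) :
    IsRev {p : St V Q × St V Q | DL ρ D x p.1 p.2} := by
  constructor
  · intro p r r' h1 h2
    change DL ρ D x _ _ at h1
    change DL ρ D x _ _ at h2
    cases h1 <;> cases h2
    · rename_i a _ b
      rw [hD.1 _ _ _ a b]
    · rfl
    · rfl
  · intro p r r' h1 h2
    change DL ρ D x _ _ at h1
    change DL ρ D x _ _ at h2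
    cases h1 <;> cases h2
    · rename_i a _ b
      rw [hD.2 _ _ _ a b]
    · rfl
    · rfl

theorem DS_rev {ρ : Q → Bool} {D : V → Set (Q × Q)} {x : V} (hD : ∀ v, IsRev (D v)) :
    IsRev {p : St V Q × St V Q | DS ρ D x p.1 p.2} := by
  have H1 := fun v => (hD v).1
  have H2 := fun v => (hD v).2
  unfold IsDet at H1
  constructor
  · intro p r r' h1 h2
    change DS ρ D x _ _ at h1
    change DS ρ D x _ _ at h2
    cases h1 <;> cases h2 <;> grind
  · intro p r r' h1 h2
    change DS ρ D x _ _ at h1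
    change DS ρ D x _ _ at h2
    cases h1 <;> cases h2 <;> grind

theorem ffM_rev {A B : Type} {M : TwoWayAutomaton Q B} (u : A → Option V) (o : V → A → B) (v0 : V)
    (hM : M.Reversible) : (ffM M u o v0).Reversible := by
  rintro (_ | _ | a)
  · exact DL_rev (hM _)
  · exact DK_rev (fun _ => hM _)
  · change IsRev (ffδ M u o v0 (.sym a))
    simp only [ffδ]
    split
    · exact DK_rev (fun _ => hM _)
    · exact DS_rev (fun _ => hM _)

def Sh (h : Q → ℤ) (c : V → ℤ) (K W : ℤ) : St V Q → ℤ
  | .s v q => c v + h q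
  | .u v q => c v + 2 * K - 1 - h q
  | .w q => W + h q

theorem DK_nc {ρ : Q → Bool} {h : Q → ℤ} {c : V → ℤ} {K W : ℤ} {D : V → Set (Q × Q)}
    (h0 : ∀ q, 0 ≤ h q ∧ h q < K) (hc : ∀ v, 0 ≤ c v ∧ c v + 2 * K ≤ W)
    (hcc : ∀ v v', v ≠ v' → c v + 2 * K ≤ c v' ∨ c v' + 2 * K ≤ c v)
    (hD : ∀ v, NCf ρ h (D v)) :
    NCf (Sρ ρ) (Sh h c K W) {p : St V Q × St V Q | DK D p.1 p.2} := by
  intro q r q' r' e e'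
  change DK D _ _ at e
  change DK D _ _ at e'
  rcases e with @⟨v, q, r, e⟩ | @⟨v, q⟩ | @⟨q⟩ <;>
    rcases e' with @⟨v', q', r', e'⟩ | @⟨v', q'⟩ | @⟨q'⟩
  · have b1 := h0 q; have b2 := h0 r; have b3 := h0 q'; have b4 := h0 r'
    have c1 := hc v; have c2 := hc v'
    have c3 := hcc v v'
    have x1 : v = v' → _ := fun hv : v = v' => hD v _ _ _ _ e (hv ▸ e')
    clear hcc hc h0 hD
    by_cases hv : v = v'
    · subst hv
      have x1 := x1 rfl
      cases h1 : ρ q <;> cases h2 : ρ r <;> cases h3 : ρ q' <;> cases h4 : ρ r' <;>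
        simp only [Xing, ps, pt, Sρ, Sh, h1, h2, h3, h4, if_true, if_false, Bool.false_eq_true] at * <;>
        omega
    · have c3 := c3 hv
      cases h1 : ρ q <;> cases h2 : ρ r <;> cases h3 : ρ q' <;> cases h4 : ρ r' <;>
        simp only [Xing, ps, pt, Sρ, Sh, h1, h2, h3, h4, if_true, if_false, Bool.false_eq_true] <;>
        omega
  · have b1 := h0 q; have b2 := h0 r; have b3 := h0 q'
    have c1 := hc v; have c2 := hc v'
    have c3 : c v = c v' ∨ c v + 2 * K ≤ c v' ∨ c v' + 2 * K ≤ c v := by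
      by_cases hv : v = v'
      · exact .inl (congrArg c hv)
      · exact .inr (hcc v v' hv)
    cases h1 : ρ q <;> cases h2 : ρ r <;> cases h3 : ρ q' <;>
      simp only [Xing, ps, pt, Sρ, Sh, h1, h2, h3, if_true, if_false, Bool.false_eq_true, Bool.not_true, Bool.not_false] <;>
      omega
  · have b1 := h0 q; have b2 := h0 r; have b3 := h0 q'
    have c1 := hc v
    cases h1 : ρ q <;> cases h2 : ρ r <;> cases h3 : ρ q' <;>
      simp only [Xing, ps, pt, Sρ, Sh, h1, h2, h3, if_true, if_false, Bool.false_eq_true] <;>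
      omega
  · have b1 := h0 q; have b2 := h0 r'; have b3 := h0 q'
    have c1 := hc v; have c2 := hc v'
    have c3 : c v = c v' ∨ c v + 2 * K ≤ c v' ∨ c v' + 2 * K ≤ c v := by
      by_cases hv : v = v'
      · exact .inl (congrArg c hv)
      · exact .inr (hcc v v' hv)
    cases h1 : ρ q <;> cases h2 : ρ r' <;> cases h3 : ρ q' <;>
      simp only [Xing, ps, pt, Sρ, Sh, h1, h2, h3, if_true, if_false, Bool.false_eq_true, Bool.not_true, Bool.not_false] <;>
      omega
  · cases h1 : ρ q <;> cases h3 : ρ q' <;>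
      simp only [Xing, ps, pt, Sρ, Sh, h1, h3, if_true, if_false, Bool.false_eq_true, Bool.not_true, Bool.not_false] <;>
      omega
  · cases h1 : ρ q <;> cases h3 : ρ q' <;>
      simp only [Xing, ps, pt, Sρ, Sh, h1, h3, if_true, if_false, Bool.false_eq_true, Bool.not_true, Bool.not_false] <;>
      omega
  · have b1 := h0 q; have b2 := h0 r'; have b3 := h0 q'
    have c1 := hc v'
    cases h1 : ρ q <;> cases h2 : ρ r' <;> cases h3 : ρ q' <;>
      simp only [Xing, ps, pt, Sρ, Sh, h1, h2, h3, if_true, if_false, Bool.false_eq_true] <;>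
      omega
  · cases h1 : ρ q <;> cases h3 : ρ q' <;>
      simp only [Xing, ps, pt, Sρ, Sh, h1, h3, if_true, if_false, Bool.false_eq_true, Bool.not_true, Bool.not_false] <;>
      omega
  · cases h1 : ρ q <;> cases h3 : ρ q' <;>
      simp only [Xing, ps, pt, Sρ, Sh, h1, h3, if_true, if_false, Bool.false_eq_true] <;>
      omega

theorem DS_cases {ρ : Q → Bool} {h : Q → ℤ} {c : V → ℤ} {K W : ℤ} {D : V → Set (Q × Q)} {x : V}
    {q r : St V Q} (e : DS ρ D x q r) (a b : ℤ)
    (ha : a = ps (Sρ ρ) (Sh h c K W) q) (hb : b = pt (Sρ ρ) (Sh h c K W) r) :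
    (∃ v q0 r0, (q0, r0) ∈ D v ∧
      ((ρ q0 = true ∧ ps ρ h q0 = -1 - h q0 ∧ a = ps ρ h q0 - c v) ∨
        (ρ q0 = false ∧ ps ρ h q0 = h q0 ∧ a = ps ρ h q0 - c v - 2 * K)) ∧
      ((ρ r0 = false ∧ pt ρ h r0 = -1 - h r0 ∧ b = pt ρ h r0 - c v) ∨
        (ρ r0 = true ∧ pt ρ h r0 = h r0 ∧ b = pt ρ h r0 - c v - 2 * K))) ∨
    (∃ q0, (a = c x + 2 * K - 1 - h q0 ∧ b = W + h q0) ∨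
      (b = c x + 2 * K - 1 - h q0 ∧ a = W + h q0)) ∨
    (∃ q0, (a = -1 - (W + h q0) ∧ b = c x + h q0) ∨
      (b = -1 - (W + h q0) ∧ a = c x + h q0)) := by
  subst ha hb
  rcases e with @⟨v, q, r, e, h1, h2⟩ | @⟨v, q, r, e, h1, h2⟩ | @⟨v, q, r, e, h1, h2⟩ |
    @⟨v, q, r, e, h1, h2⟩ | @⟨q, h1⟩ | @⟨q, h1⟩ | @⟨q, h1⟩ | @⟨q, h1⟩
  · left
    refine ⟨v, q, r, e, ?_, ?_⟩ <;>
      simp [ps, pt, Sρ, Sh, h1, h2] <;> omega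
  · left
    refine ⟨v, q, r, e, ?_, ?_⟩ <;>
      simp [ps, pt, Sρ, Sh, h1, h2] <;> omega
  · left
    refine ⟨v, q, r, e, ?_, ?_⟩ <;>
      simp [ps, pt, Sρ, Sh, h1, h2] <;> omega
  · left
    refine ⟨v, q, r, e, ?_, ?_⟩ <;>
      simp [ps, pt, Sρ, Sh, h1, h2] <;> omega
  · right; left
    refine ⟨q, .inl ?_⟩
    simp [ps, pt, Sρ, Sh, h1]
  · right; right
    refine ⟨q, .inl ?_⟩
    simp [ps, pt, Sρ, Sh, h1]
  · right; left
    refine ⟨q, .inr ?_⟩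
    simp [ps, pt, Sρ, Sh, h1]
  · right; right
    refine ⟨q, .inr ?_⟩
    simp [ps, pt, Sρ, Sh, h1]

theorem DS_nc {ρ : Q → Bool} {h : Q → ℤ} {c : V → ℤ} {K W : ℤ} {D : V → Set (Q × Q)} {x : V}
    (h0 : ∀ q, 0 ≤ h q ∧ h q < K) (hc : ∀ v, 0 ≤ c v ∧ c v + 2 * K ≤ W)
    (hcc : ∀ v v', v ≠ v' → c v + 2 * K ≤ c v' ∨ c v' + 2 * K ≤ c v)
    (hD : ∀ v, NCf ρ h (D v)) :
    NCf (Sρ ρ) (Sh h c K W) {p : St V Q × St V Q | DS ρ D x p.1 p.2} := by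
  intro q r q' r' e e'
  change DS ρ D x _ _ at e
  change DS ρ D x _ _ at e'
  have E := DS_cases (h := h) (c := c) (K := K) (W := W) e _ _ rfl rfl
  have E' := DS_cases (h := h) (c := c) (K := K) (W := W) e' _ _ rfl rfl
  generalize ps (Sρ ρ) (Sh h c K W) q = a at *
  generalize pt (Sρ ρ) (Sh h c K W) r = b at *
  generalize ps (Sρ ρ) (Sh h c K W) q' = a' at *
  generalize pt (Sρ ρ) (Sh h c K W) r' = b' at *
  have cx := hc x
  clear e e'
  rcases E with ⟨v, q, r, e, E⟩ | ⟨q, E⟩ | ⟨q, E⟩ <;>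
    rcases E' with ⟨v', q', r', e', E'⟩ | ⟨q', E'⟩ | ⟨q', E'⟩
  · have b1 := h0 q; have b2 := h0 r; have b3 := h0 q'; have b4 := h0 r'
    have c1 := hc v; have c2 := hc v'
    by_cases hv : v = v'
    · subst hv
      have x1 := hD v _ _ _ _ e e'
      have x2 := hD v _ _ _ _ e' e
      unfold Xing at *
      rcases E.1 with ⟨-, k1, k2⟩ | ⟨-, k1, k2⟩ <;> rcases E.2 with ⟨-, k3, k4⟩ | ⟨-, k3, k4⟩ <;>
      rcases E'.1 with ⟨-, k5, k6⟩ | ⟨-, k5, k6⟩ <;> rcases E'.2 with ⟨-, k7, k8⟩ | ⟨-, k7, k8⟩ <;>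
        clear E E' <;> omega
    · have c3 := hcc v v' hv
      unfold Xing at *
      have k1 : - c v - 2 * K ≤ a ∧ a < - c v := by omega
      have k2 : - c v - 2 * K ≤ b ∧ b < - c v := by omega
      have k3 : - c v' - 2 * K ≤ a' ∧ a' < - c v' := by omega
      have k4 : - c v' - 2 * K ≤ b' ∧ b' < - c v' := by omega
      clear E E'
      omega
  · have b1 := h0 q; have b2 := h0 r; have b3 := h0 q'; have c1 := hc v
    unfold Xing; omega
  · have b1 := h0 q; have b2 := h0 r; have b3 := h0 q'; have c1 := hc v
    unfold Xing; omega
  · have b1 := h0 q; have b2 := h0 r'; have b3 := h0 q'; have c1 := hc v'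
    unfold Xing; omega
  · have b1 := h0 q; have b3 := h0 q'
    unfold Xing; omega
  · have b1 := h0 q; have b3 := h0 q'
    unfold Xing; omega
  · have b1 := h0 q; have b2 := h0 r'; have b3 := h0 q'; have c1 := hc v'
    unfold Xing; omega
  · have b1 := h0 q; have b3 := h0 q'
    unfold Xing; omega
  · have b1 := h0 q; have b3 := h0 q'
    unfold Xing; omega

theorem ffM_planar {A B : Type} [Finite V] [Finite Q] {M : TwoWayAutomaton Q B}
    (u : A → Option V) (o : V → A → B) (v0 : V)
    (hM : M.Planar) : (ffM M u o v0).Planar := by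
  obtain ⟨lt, hlt, hp⟩ := hM
  obtain ⟨K0, h, h0, hi, hl⟩ := exists_rank lt hlt
  obtain ⟨K, hK0⟩ : ∃ K : ℤ, K = K0 := ⟨_, rfl⟩
  rw [← hK0] at h0
  obtain ⟨k, ⟨e⟩⟩ := Finite.exists_equiv_fin V
  have hK : 0 < K := by have := h0 M.init; omega
  let c : V → ℤ := fun v => 2 * K * ((e v : ℕ) : ℤ)
  have hcc : ∀ v v', v ≠ v' → c v + 2 * K ≤ c v' ∨ c v' + 2 * K ≤ c v := by
    intro v v' hv
    have : (e v : ℕ) ≠ e v' := fun h => hv (e.injective (Fin.ext h))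
    rcases lt_or_gt_of_ne this with h | h
    · left
      have : ((e v : ℕ) : ℤ) + 1 ≤ ((e v' : ℕ) : ℤ) := by omega
      have := mul_le_mul_of_nonneg_left this (by omega : 0 ≤ 2 * K)
      simp only [c]; linarith
    · right
      have : ((e v' : ℕ) : ℤ) + 1 ≤ ((e v : ℕ) : ℤ) := by omega
      have := mul_le_mul_of_nonneg_left this (by omega : 0 ≤ 2 * K)
      simp only [c]; linarith
  have hc : ∀ v, 0 ≤ c v ∧ c v + 2 * K ≤ 2 * K * k := by
    intro v
    have : ((e v : ℕ) : ℤ) + 1 ≤ (k : ℤ) := by have := (e v).2; omega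
    have := mul_le_mul_of_nonneg_left this (by omega : 0 ≤ 2 * K)
    refine ⟨by positivity, ?_⟩
    simp only [c]; linarith
  have hNC : ∀ b, NCf M.ρ h (M.δ (.sym b)) := fun b => NCf_of_planar (fun q => (h0 q).1) hl (hp b)
  have hcd : ∀ v v', v = v' ∨ c v + 2 * K ≤ c v' ∨ c v' + 2 * K ≤ c v := fun v v' =>
    or_iff_not_imp_left.2 (hcc v v')
  clear_value c
  refine planar_intro (Sh h c K (2 * K * k)) ?_ ?_ ?_
  · rintro (⟨v, q⟩ | ⟨v, q⟩ | q)
    · have := h0 q; have := hc v; simp only [Sh]; omega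
    · have := h0 q; have := hc v; simp only [Sh]; omega
    · have := h0 q; have := hc v0; simp only [Sh]; omega
  · generalize 2 * K * k = W at *
    rintro (⟨v, q⟩ | ⟨v, q⟩ | q) (⟨v', q'⟩ | ⟨v', q'⟩ | q') hh <;> simp only [Sh] at hh <;>
      have b1 := h0 q <;> have b2 := h0 q' <;> try have c1 := hc v
    · rcases hcd v v' with rfl | h
      · rw [hi (by omega : h q = h q')]
      · omega
    · rcases hcd v v' with rfl | h
      · omega
      · omega
    · omega
    · rcases hcd v v' with rfl | h
      · omega
      · omega
    · rcases hcd v v' with rfl | h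
      · rw [hi (by omega : h q = h q')]
      · omega
    · omega
    · have := hc v'; omega
    · have := hc v'; omega
    · rw [hi (by omega : h q = h q')]
  · intro a
    change NCf (Sρ M.ρ) _ (ffδ M u o v0 (.sym a))
    simp only [ffδ]
    split
    · exact DK_nc h0 hc hcc fun _ => hNC _
    · exact DS_nc h0 hc hcc fun _ => hNC _

end

section
variable {Q V : Type}

theorem CE_l {x : Prof Unit Q} {ρ : Q → Bool} {f : Set (Q × Q)} {t : Unit} {b : Nd Unit Q Q} :
    CE x (prof ρ f) (.l t) b ↔ ∃ d, x (.inl t) d ∧ b = e12 d := by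
  constructor
  · generalize ha : (Nd.l t : Nd Unit Q Q) = a
    rintro (@⟨u, v, h⟩ | @⟨u, v, h⟩)
    · rcases u with u | u <;> cases ha
      exact ⟨_, h, rfl⟩
    · rcases u with u | u <;> cases ha
  · rintro ⟨d, h, rfl⟩
    exact CE.left h

theorem prof_inv {ρ : Q → Bool} {f : Set (Q × Q)} {u v : Q ⊕ Q} (h : prof ρ f u v) :
    ∃ q r, (q, r) ∈ f ∧ u = srcN ρ q ∧ v = tgtN ρ r := by
  rcases h with ⟨h⟩
  exact ⟨_, _, h, rfl, rfl⟩

theorem srcN_inl {ρ : Q → Bool} {q q' : Q} : (Sum.inl q' : Q ⊕ Q) = srcN ρ q ↔ ρ q = true ∧ q' = q := by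
  cases h : ρ q
  · simp [srcN_f h]
  · simp [srcN_t h]
theorem srcN_inr {ρ : Q → Bool} {q q' : Q} : (Sum.inr q' : Q ⊕ Q) = srcN ρ q ↔ ρ q = false ∧ q' = q := by
  cases h : ρ q
  · simp [srcN_f h]
  · simp [srcN_t h]

theorem CE_m {x : Prof Unit Q} {ρ : Q → Bool} {f : Set (Q × Q)} {p : Q} {b : Nd Unit Q Q} :
    CE x (prof ρ f) (.m p) b ↔ (∃ d, x (.inr p) d ∧ b = e12 d) ∨
      (ρ p = true ∧ ∃ r, (p, r) ∈ f ∧ b = e23 (tgtN ρ r)) := by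
  constructor
  · generalize ha : (Nd.m p : Nd Unit Q Q) = a
    rintro (@⟨u, v, h⟩ | @⟨u, v, h⟩)
    · rcases u with u | u <;> cases ha
      exact .inl ⟨_, h, rfl⟩
    · rcases u with u | u <;> cases ha
      obtain ⟨q, r, h, h1, rfl⟩ := prof_inv h
      obtain ⟨h1, rfl⟩ := srcN_inl.1 h1
      exact .inr ⟨h1, _, h, rfl⟩
  · rintro (⟨d, h, rfl⟩ | ⟨h, r, h1, rfl⟩)
    · exact CE.left h
    · exact CE.right (u := .inl p) (prof_mk' h1 (srcN_t h) rfl)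

theorem CE_r {x : Prof Unit Q} {ρ : Q → Bool} {f : Set (Q × Q)} {p : Q} {b : Nd Unit Q Q} :
    CE x (prof ρ f) (.r p) b ↔ 
      (ρ p = false ∧ ∃ r, (p, r) ∈ f ∧ b = e23 (tgtN ρ r)) := by
  constructor
  · generalize ha : (Nd.r p : Nd Unit Q Q) = a
    rintro (@⟨u, v, h⟩ | @⟨u, v, h⟩)
    · rcases u with u | u <;> cases ha
    · rcases u with u | u <;> cases ha
      obtain ⟨q, r, h, h1, rfl⟩ := prof_inv h
      obtain ⟨h1, rfl⟩ := srcN_inr.1 h1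
      exact ⟨h1, _, h, rfl⟩
  · rintro ⟨h, r, h1, rfl⟩
    exact CE.right (u := .inr p) (prof_mk' h1 (srcN_f h) rfl)

theorem tg_t {ρ : Q → Bool} {r : Q} (h : ρ r = true) : (e23 (tgtN ρ r) : Nd Unit Q Q) = .r r := by
  rw [tgtN_t h]; rfl
theorem tg_f {ρ : Q → Bool} {r : Q} (h : ρ r = false) : (e23 (tgtN ρ r) : Nd Unit Q Q) = .m r := by
  rw [tgtN_f h]; rfl

theorem sim_fwd {N N' : Type} {E : N → N → Prop} {F : N' → N' → Prop} {B : N → N' → Prop}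
    (hB : ∀ a b a', B a b → E a a' → ∃ b', B a' b' ∧ ReflTransGen F b b')
    {a a' : N} {b : N'} (h : TransGen E a a') (hab : B a b) :
    ∃ b', B a' b' ∧ ReflTransGen F b b' := by
  induction h with
  | single h => exact hB _ _ _ hab h
  | tail _ h ih =>
    obtain ⟨b1, h1, h2⟩ := ih
    obtain ⟨b2, h3, h4⟩ := hB _ _ _ h1 h
    exact ⟨b2, h3, h2.trans h4⟩

theorem reach {N : Type} {E : N → N → Prop} (S : N → Prop) {a d : N} (h : TransGen E a d)
    (h0 : ∀ b, E a b → S b) (hS : ∀ b c, S b → E b c → S c) : S d := by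
  induction h with
  | single h => exact h0 _ h
  | tail _ h ih => exact hS _ _ ih h

def emb (v : V) : Unit ⊕ Q → Unit ⊕ St V Q
  | .inl t => .inl t
  | .inr q => .inr (.s v q)

structure INV (ρ : Q → Bool) (v : V) (x : Prof Unit (St V Q)) (y : Prof Unit Q) : Prop where
  i1 : ∀ s d, x (emb v s) d ↔ ∃ d', d = emb v d' ∧ y s d'
  i2 : ∀ q d, x (.inr (.u v q)) d ↔ ρ q = true ∧ d = .inr (.w q)
  i3 : ∀ q d, x (.inr (.w q)) d ↔ ρ q = false ∧ d = .inr (.u v q)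

/-- Transfer from simulation data to the first invariant. -/
theorem i1_of {v' : V} {x' : Prof Unit (St V Q)} {y' : Prof Unit Q}
    {g : Prof (St V Q) (St V Q)} {g' : Prof Q Q}
    (hirr : ∀ s, ¬ comp x' g s s)
    (B : Nd Unit (St V Q) (St V Q) → Nd Unit Q Q → Prop)
    (ψ : Nd Unit Q Q → Nd Unit (St V Q) (St V Q))
    (hB0 : ∀ s, B (e13 (emb v' s)) (e13 s))
    (hBt : ∀ d b, B (e13 d) b → ∃ d', d = emb v' d' ∧ b = e13 d')
    (hB : ∀ a b a', B a b → CE x' g a a' → ∃ b', B a' b' ∧ ReflTransGen (CE y' g') b b')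
    (hψ0 : ∀ s, ψ (e13 s) = e13 (emb v' s))
    (hψ : ∀ b b', CE y' g' b b' → TransGen (CE x' g) (ψ b) (ψ b')) (s : Unit ⊕ Q)
    (d : Unit ⊕ St V Q) :
    comp x' g (emb v' s) d ↔ ∃ d', d = emb v' d' ∧ comp y' g' s d' := by
  constructor
  · intro h
    obtain ⟨b', h1, h2⟩ := sim_fwd hB h (hB0 s)
    obtain ⟨d', rfl, rfl⟩ := hBt _ _ h1
    refine ⟨d', rfl, ?_⟩
    rcases reflTransGen_iff_eq_or_transGen.1 h2 with h3 | h3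
    · exfalso
      have : d' = s := by
        rcases d' with d' | d' <;> rcases s with s | s <;> cases h3 <;> rfl
      subst this
      exact hirr _ h
    · exact h3
  · rintro ⟨d', rfl, h⟩
    have := tg_lift' ψ hψ h
    rw [hψ0, hψ0] at this
    exact this

inductive BK (v : V) : Nd Unit (St V Q) (St V Q) → Nd Unit Q Q → Prop
  | l {t} : BK v (.l t) (.l t)
  | m {q} : BK v (.m (.s v q)) (.m q)
  | r {q} : BK v (.r (.s v q)) (.r q)

def ψK (v v' : V) : Nd Unit Q Q → Nd Unit (St V Q) (St V Q)
  | .l t => .l t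
  | .m q => .m (.s v q)
  | .r q => .r (.s v' q)

theorem BK_e12 (v : V) (d : Unit ⊕ Q) : BK v (e12 (emb v d)) (e12 d) := by
  rcases d with d | d
  · exact .l
  · exact .m

theorem BK_e13 (v : V) (d : Unit ⊕ Q) : BK v (e13 (emb v d)) (e13 d) := by
  rcases d with d | d
  · exact .l
  · exact .r

theorem BK_tgt (ρ : Q → Bool) (v : V) (q : Q) :
    BK v (e23 (tgtN (Sρ ρ) (.s v q))) (e23 (tgtN ρ q)) := by
  cases h : ρ q
  · rw [tg_f h, tg_f (ρ := Sρ ρ) (r := .s v q) h]; exact .m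
  · rw [tg_t h, tg_t (ρ := Sρ ρ) (r := .s v q) h]; exact .r

theorem BK_inv {v : V} {d : Unit ⊕ St V Q} {b} (h : BK v (e13 d) b) :
    ∃ d', d = emb v d' ∧ b = e13 d' := by
  generalize ha : (e13 d : Nd Unit (St V Q) (St V Q)) = a at h
  rcases h with @⟨t⟩ | @⟨q⟩ | @⟨q⟩
  · rcases d with d | d <;> cases ha
    exact ⟨.inl (), rfl, rfl⟩
  · rcases d with d | d <;> cases ha
  · rcases d with d | d <;> cases ha
    exact ⟨.inr q, rfl, rfl⟩

theorem ψK_e12 (v v' : V) (d : Unit ⊕ Q) : ψK v v' (e12 d) = e12 (emb v d) := by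
  cases d <;> rfl
theorem ψK_e13 (v v' : V) (d : Unit ⊕ Q) : ψK v v' (e13 d) = e13 (emb v' d) := by
  cases d <;> rfl
theorem ψK_tgt (ρ : Q → Bool) (v : V) (q : Q) :
    ψK v v (e23 (tgtN ρ q)) = e23 (tgtN (Sρ ρ) (.s v q)) := by
  cases h : ρ q
  · rw [tg_f h, tg_f (ρ := Sρ ρ) (r := .s v q) h]; rfl
  · rw [tg_t h, tg_t (ρ := Sρ ρ) (r := .s v q) h]; rfl

theorem INV_base {ρ : Q → Bool} {v : V} {D : Set (Q × Q)} {q0 : Q}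
    (hirr : ∀ s, ¬ comp (startP (.s v q0)) (prof (Sρ ρ) {p : St V Q × St V Q | DL ρ D v p.1 p.2}) s s) :
    INV ρ v (comp (startP (.s v q0)) (prof (Sρ ρ) {p : St V Q × St V Q | DL ρ D v p.1 p.2}))
      (comp (startP q0) (prof ρ D)) := by
  constructor
  · refine i1_of hirr (BK v) (ψK v v) (BK_e13 v) (fun _ _ => BK_inv) ?_ (ψK_e13 v v) ?_
    · rintro _ _ a' (_ | _ | _) h
      · obtain ⟨d, h1, rfl⟩ := CE_l.1 h
        cases h1
        exact ⟨_, .m, .single (CE_l.2 ⟨_, .mk, rfl⟩)⟩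
      · rcases CE_m.1 h with ⟨d, h1, rfl⟩ | ⟨h1, r, h2, rfl⟩
        · cases h1
        · change DL ρ D v _ _ at h2
          rcases h2 with h2 | h2 | h2
          exact ⟨_, BK_tgt _ _ _, .single (CE_m.2 (.inr ⟨h1, _, h2, rfl⟩))⟩
      · obtain ⟨h1, r, h2, rfl⟩ := CE_r.1 h
        change DL ρ D v _ _ at h2
        rcases h2 with h2 | h2 | h2
        exact ⟨_, BK_tgt _ _ _, .single (CE_r.2 ⟨h1, _, h2, rfl⟩)⟩
    · rintro (a | a | a) b h
      · obtain ⟨d, h1, rfl⟩ := CE_l.1 h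
        cases h1
        exact .single (CE_l.2 ⟨_, .mk, rfl⟩)
      · rcases CE_m.1 h with ⟨d, h1, rfl⟩ | ⟨h1, r, h2, rfl⟩
        · cases h1
        · rw [ψK_tgt]
          exact .single (CE_m.2 (.inr ⟨h1, _, .s h2, rfl⟩))
      · obtain ⟨h1, r, h2, rfl⟩ := CE_r.1 h
        rw [ψK_tgt]
        exact .single (CE_r.2 ⟨h1, _, .s h2, rfl⟩)
  · intro q d
    constructor
    · intro h
      have key : ρ q = true ∧ (e13 d : Nd Unit (St V Q) (St V Q)) = .r (.w q) := by
        refine reach (fun n => ρ q = true ∧ n = .r (.w q)) h ?_ ?_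
        · intro b h
          obtain ⟨h1, r, h2, rfl⟩ := CE_r.1 h
          change DL ρ D v _ _ at h2
          rcases h2 with h2 | h2 | h2
          exact ⟨h2, tg_t h2⟩
        · rintro _ c ⟨h0, rfl⟩ h
          obtain ⟨h1, r, h2, rfl⟩ := CE_r.1 h
          exact absurd (h0.symm.trans h1) (by simp)
      refine ⟨key.1, ?_⟩
      have := key.2
      rcases d with d | d <;> cases this
      rfl
    · rintro ⟨h, rfl⟩
      refine .single (CE_r.2 ⟨by simp [Sρ, h], _, .uw h, (tg_t ?_).symm⟩)
      exact h
  · intro q d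
    constructor
    · intro h
      have key : ρ q = false ∧ (e13 d : Nd Unit (St V Q) (St V Q)) = .r (.u v q) := by
        refine reach (fun n => ρ q = false ∧ n = .r (.u v q)) h ?_ ?_
        · intro b h
          obtain ⟨h1, r, h2, rfl⟩ := CE_r.1 h
          change DL ρ D v _ _ at h2
          rcases h2 with h2 | h2 | h2
          exact ⟨h2, tg_t (by simp [Sρ, h2])⟩
        · rintro _ c ⟨h0, rfl⟩ h
          obtain ⟨h1, r, h2, rfl⟩ := CE_r.1 h
          simp [Sρ, h0] at h1
      refine ⟨key.1, ?_⟩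
      have := key.2
      rcases d with d | d <;> cases this
      rfl
    · rintro ⟨h, rfl⟩
      refine .single (CE_r.2 ⟨h, _, .wu h, (tg_t ?_).symm⟩)
      simp [Sρ, h]

theorem INV_keep {ρ : Q → Bool} {v : V} {D : V → Set (Q × Q)} {x : Prof Unit (St V Q)}
    {y : Prof Unit Q} (I : INV ρ v x y)
    (hirr : ∀ s, ¬ comp x (prof (Sρ ρ) {p : St V Q × St V Q | DK D p.1 p.2}) s s) :
    INV ρ v (comp x (prof (Sρ ρ) {p : St V Q × St V Q | DK D p.1 p.2}))
      (comp y (prof ρ (D v))) := by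
  constructor
  · refine i1_of hirr (BK v) (ψK v v) (BK_e13 v) (fun _ _ => BK_inv) ?_ (ψK_e13 v v) ?_
    · rintro _ _ a' (_ | @⟨q⟩ | _) h
      · obtain ⟨d, h1, rfl⟩ := CE_l.1 h
        obtain ⟨d', rfl, h3⟩ := (I.i1 (.inl ()) _).1 h1
        exact ⟨_, BK_e12 _ _, .single (CE_l.2 ⟨_, h3, rfl⟩)⟩
      · rcases CE_m.1 h with ⟨d, h1, rfl⟩ | ⟨h1, r, h2, rfl⟩
        · obtain ⟨d', rfl, h3⟩ := (I.i1 (.inr q) _).1 h1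
          exact ⟨_, BK_e12 _ _, .single (CE_m.2 (.inl ⟨_, h3, rfl⟩))⟩
        · change DK D _ _ at h2
          rcases h2 with h2 | h2 | h2
          exact ⟨_, BK_tgt _ _ _, .single (CE_m.2 (.inr ⟨h1, _, h2, rfl⟩))⟩
      · obtain ⟨h1, r, h2, rfl⟩ := CE_r.1 h
        change DK D _ _ at h2
        rcases h2 with h2 | h2 | h2
        exact ⟨_, BK_tgt _ _ _, .single (CE_r.2 ⟨h1, _, h2, rfl⟩)⟩
    · rintro (a | a | a) b h
      · obtain ⟨d, h1, rfl⟩ := CE_l.1 h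
        rw [ψK_e12]
        exact .single (CE_l.2 ⟨_, (I.i1 (.inl ()) _).2 ⟨d, rfl, h1⟩, rfl⟩)
      · rcases CE_m.1 h with ⟨d, h1, rfl⟩ | ⟨h1, r, h2, rfl⟩
        · rw [ψK_e12]
          exact .single (CE_m.2 (.inl ⟨_, (I.i1 (.inr a) _).2 ⟨d, rfl, h1⟩, rfl⟩))
        · rw [ψK_tgt]
          exact .single (CE_m.2 (.inr ⟨h1, _, .s h2, rfl⟩))
      · obtain ⟨h1, r, h2, rfl⟩ := CE_r.1 h
        rw [ψK_tgt]
        exact .single (CE_r.2 ⟨h1, _, .s h2, rfl⟩)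
  · intro q d
    constructor
    · intro h
      have key : ρ q = true ∧ ((e13 d : Nd Unit (St V Q) (St V Q)) = .m (.u v q) ∨
          (e13 d : Nd Unit (St V Q) (St V Q)) = .m (.w q) ∨
          (e13 d : Nd Unit (St V Q) (St V Q)) = .r (.w q)) := by
        refine reach (fun n => ρ q = true ∧
          (n = .m (.u v q) ∨ n = .m (.w q) ∨ n = .r (.w q))) h ?_ ?_
        · intro b h
          obtain ⟨h1, r, h2, rfl⟩ := CE_r.1 h
          have h1' : ρ q = true := by simpa [Sρ] using h1
          change DK D _ _ at h2
          rcases h2 with h2 | h2 | h2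
          exact ⟨h1', .inl (tg_f h1)⟩
        · rintro _ c ⟨h0, rfl | rfl | rfl⟩ h
          · refine ⟨h0, ?_⟩
            rcases CE_m.1 h with ⟨d, h1, rfl⟩ | ⟨h1, r, h2, rfl⟩
            · obtain ⟨_, rfl⟩ := (I.i2 _ _).1 h1
              exact .inr (.inl rfl)
            · simp [Sρ, h0] at h1
          · refine ⟨h0, ?_⟩
            rcases CE_m.1 h with ⟨d, h1, rfl⟩ | ⟨h1, r, h2, rfl⟩
            · obtain ⟨h3, rfl⟩ := (I.i3 _ _).1 h1
              simp [h0] at h3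
            · change DK D _ _ at h2
              rcases h2 with h2 | h2 | h2
              exact .inr (.inr (tg_t h1))
          · obtain ⟨h1, r, h2, rfl⟩ := CE_r.1 h
            exact absurd (h0.symm.trans h1) (by simp)
      refine ⟨key.1, ?_⟩
      have := key.2
      rcases d with d | d <;> rcases this with this | this | this <;> cases this
      rfl
    · rintro ⟨h, rfl⟩
      have h' : Sρ ρ (.u v q) = false := by simp [Sρ, h]
      have s1 : CE x (prof (Sρ ρ) {p : St V Q × St V Q | DK D p.1 p.2})
          (.r (.u v q)) (.m (.u v q)) := CE_r.2 ⟨h', _, .u, (tg_f h').symm⟩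
      have s2 : CE x (prof (Sρ ρ) {p : St V Q × St V Q | DK D p.1 p.2})
          (.m (.u v q)) (.m (.w q)) := CE_m.2 (.inl ⟨_, (I.i2 _ _).2 ⟨h, rfl⟩, rfl⟩)
      have s3 : CE x (prof (Sρ ρ) {p : St V Q × St V Q | DK D p.1 p.2})
          (.m (.w q)) (.r (.w q)) := CE_m.2 (.inr ⟨h, _, .w, (tg_t (by exact h)).symm⟩)
      exact ((TransGen.single s1).tail s2).tail s3
  · intro q d
    constructor
    · intro h
      have key : ρ q = false ∧ ((e13 d : Nd Unit (St V Q) (St V Q)) = .m (.w q) ∨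
          (e13 d : Nd Unit (St V Q) (St V Q)) = .m (.u v q) ∨
          (e13 d : Nd Unit (St V Q) (St V Q)) = .r (.u v q)) := by
        refine reach (fun n => ρ q = false ∧
          (n = .m (.w q) ∨ n = .m (.u v q) ∨ n = .r (.u v q))) h ?_ ?_
        · intro b h
          obtain ⟨h1, r, h2, rfl⟩ := CE_r.1 h
          change DK D _ _ at h2
          rcases h2 with h2 | h2 | h2
          exact ⟨h1, .inl (tg_f h1)⟩
        · rintro _ c ⟨h0, rfl | rfl | rfl⟩ h
          · refine ⟨h0, ?_⟩
            rcases CE_m.1 h with ⟨d, h1, rfl⟩ | ⟨h1, r, h2, rfl⟩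
            · obtain ⟨_, rfl⟩ := (I.i3 _ _).1 h1
              exact .inr (.inl rfl)
            · simp [Sρ, h0] at h1
          · refine ⟨h0, ?_⟩
            rcases CE_m.1 h with ⟨d, h1, rfl⟩ | ⟨h1, r, h2, rfl⟩
            · obtain ⟨h3, rfl⟩ := (I.i2 _ _).1 h1
              simp [h0] at h3
            · change DK D _ _ at h2
              rcases h2 with h2 | h2 | h2
              exact .inr (.inr (tg_t h1))
          · obtain ⟨h1, r, h2, rfl⟩ := CE_r.1 h
            simp [Sρ, h0] at h1
      refine ⟨key.1, ?_⟩
      have := key.2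
      rcases d with d | d <;> rcases this with this | this | this <;> cases this
      rfl
    · rintro ⟨h, rfl⟩
      have h' : Sρ ρ (.u v q) = true := by simp [Sρ, h]
      have s1 : CE x (prof (Sρ ρ) {p : St V Q × St V Q | DK D p.1 p.2})
          (.r (.w q)) (.m (.w q)) := CE_r.2 ⟨h, _, .w, (tg_f (by exact h)).symm⟩
      have s2 : CE x (prof (Sρ ρ) {p : St V Q × St V Q | DK D p.1 p.2})
          (.m (.w q)) (.m (.u v q)) := CE_m.2 (.inl ⟨_, (I.i3 _ _).2 ⟨h, rfl⟩, rfl⟩)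
      have s3 : CE x (prof (Sρ ρ) {p : St V Q × St V Q | DK D p.1 p.2})
          (.m (.u v q)) (.r (.u v q)) := CE_m.2 (.inr ⟨h', _, .u, (tg_t h').symm⟩)
      exact ((TransGen.single s1).tail s2).tail s3

end

section
variable {Q V : Type}

inductive BS (v x : V) : Nd Unit (St V Q) (St V Q) → Nd Unit Q Q → Prop
  | l {t} : BS v x (.l t) (.l t)
  | m {q} : BS v x (.m (.s v q)) (.m q)
  | u {q} : BS v x (.m (.u v q)) (.r q)
  | w {q} : BS v x (.m (.w q)) (.r q)
  | r {q} : BS v x (.r (.s x q)) (.r q)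

theorem BS_e12 (v x : V) (d : Unit ⊕ Q) : BS v x (e12 (emb v d)) (e12 d) := by
  rcases d with d | d
  · exact .l
  · exact .m

theorem BS_e13 (v x : V) (d : Unit ⊕ Q) : BS v x (e13 (emb x d)) (e13 d) := by
  rcases d with d | d
  · exact .l
  · exact .r

theorem BS_inv {v x : V} {d : Unit ⊕ St V Q} {b} (h : BS v x (e13 d) b) :
    ∃ d', d = emb x d' ∧ b = e13 d' := by
  generalize ha : (e13 d : Nd Unit (St V Q) (St V Q)) = a at h
  rcases h with @⟨t⟩ | @⟨q⟩ | @⟨q⟩ | @⟨q⟩ | @⟨q⟩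
  · rcases d with d | d <;> cases ha
    exact ⟨.inl (), rfl, rfl⟩
  · rcases d with d | d <;> cases ha
  · rcases d with d | d <;> cases ha
  · rcases d with d | d <;> cases ha
  · rcases d with d | d <;> cases ha
    exact ⟨.inr q, rfl, rfl⟩

theorem INV_set {ρ : Q → Bool} {v z : V} {D : V → Set (Q × Q)} {x : Prof Unit (St V Q)}
    {y : Prof Unit Q} (I : INV ρ v x y)
    (hirr : ∀ s, ¬ comp x (prof (Sρ ρ) {p : St V Q × St V Q | DS ρ D z p.1 p.2}) s s) :
    INV ρ z (comp x (prof (Sρ ρ) {p : St V Q × St V Q | DS ρ D z p.1 p.2}))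
      (comp y (prof ρ (D v))) := by
  constructor
  · refine i1_of hirr (BS v z) (ψK v z) (BS_e13 v z) (fun _ _ => BS_inv) ?_ (ψK_e13 v z) ?_
    · rintro _ _ a' (_ | @⟨q⟩ | @⟨q⟩ | @⟨q⟩ | @⟨q⟩) h
      · obtain ⟨d, h1, rfl⟩ := CE_l.1 h
        obtain ⟨d', rfl, h3⟩ := (I.i1 (.inl ()) _).1 h1
        exact ⟨_, BS_e12 _ _ _, .single (CE_l.2 ⟨_, h3, rfl⟩)⟩
      · rcases CE_m.1 h with ⟨d, h1, rfl⟩ | ⟨h1, r, h2, rfl⟩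
        · obtain ⟨d', rfl, h3⟩ := (I.i1 (.inr q) _).1 h1
          exact ⟨_, BS_e12 _ _ _, .single (CE_m.2 (.inl ⟨_, h3, rfl⟩))⟩
        · change ρ q = true at h1
          change DS ρ D z _ _ at h2
          rcases h2 with ⟨h2, h3, h4⟩ | ⟨h2, h3, h4⟩ | _ | _ | _ | _ | _ | ⟨h3⟩
          · rw [tg_f (by simp [Sρ, h4])]
            exact ⟨_, .u, .single (CE_m.2 (.inr ⟨h1, _, h2, (tg_t h4).symm⟩))⟩
          · rw [tg_f (by simp [Sρ, h4])]
            exact ⟨_, .m, .single (CE_m.2 (.inr ⟨h1, _, h2, (tg_f h4).symm⟩))⟩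
          · simp [h1] at h3
      · rcases CE_m.1 h with ⟨d, h1, rfl⟩ | ⟨h1, r, h2, rfl⟩
        · obtain ⟨h3, rfl⟩ := (I.i2 _ _).1 h1
          exact ⟨_, .w, .refl⟩
        · have h1' : ρ q = false := by simpa [Sρ] using h1
          change DS ρ D z _ _ at h2
          rcases h2 with _ | _ | ⟨h2, h3, h4⟩ | ⟨h2, h3, h4⟩ | ⟨h3⟩ | _ | _ | _
          · rw [tg_f (by simp [Sρ, h4])]
            exact ⟨_, .u, .single (CE_r.2 ⟨h1', _, h2, (tg_t h4).symm⟩)⟩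
          · rw [tg_f (by simp [Sρ, h4])]
            exact ⟨_, .m, .single (CE_r.2 ⟨h1', _, h2, (tg_f h4).symm⟩)⟩
          · simp [h1'] at h3
      · rcases CE_m.1 h with ⟨d, h1, rfl⟩ | ⟨h1, r, h2, rfl⟩
        · obtain ⟨h3, rfl⟩ := (I.i3 _ _).1 h1
          exact ⟨_, .u, .refl⟩
        · change ρ q = true at h1
          change DS ρ D z _ _ at h2
          rcases h2 with _ | _ | _ | _ | _ | ⟨h3⟩ | ⟨h3⟩ | _
          · rw [tg_t (by simp [Sρ, h1])]
            exact ⟨_, .r, .refl⟩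
          · simp [h1] at h3
      · obtain ⟨h1, r, h2, rfl⟩ := CE_r.1 h
        change ρ q = false at h1
        change DS ρ D z _ _ at h2
        rcases h2 with ⟨h2, h3, h4⟩ | ⟨h2, h3, h4⟩ | _ | _ | _ | _ | _ | ⟨h3⟩
        · simp [h1] at h3
        · simp [h1] at h3
        · rw [tg_f (by simp [Sρ, h1])]
          exact ⟨_, .w, .refl⟩
    · have A1 : ∀ r, ρ r = true → TransGen (CE x (prof (Sρ ρ) {p : St V Q × St V Q | DS ρ D z p.1 p.2}))
          (.m (.u v r)) (.r (.s z r)) := by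
        intro r hr
        refine TransGen.tail (.single (b := .m (.w r)) (CE_m.2 (.inl ⟨_, (I.i2 _ _).2 ⟨hr, rfl⟩, rfl⟩))) ?_
        exact CE_m.2 (.inr ⟨hr, _, .ws hr, (tg_t (by exact hr)).symm⟩)
      have A2 : ∀ q, ρ q = false → TransGen (CE x (prof (Sρ ρ) {p : St V Q × St V Q | DS ρ D z p.1 p.2}))
          (.r (.s z q)) (.m (.u v q)) := by
        intro r hr
        refine TransGen.tail (.single (b := .m (.w r)) ?_) (CE_m.2 (.inl ⟨_, (I.i3 _ _).2 ⟨hr, rfl⟩, rfl⟩))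
        exact CE_r.2 ⟨hr, _, .sw hr, (tg_f (by exact hr)).symm⟩
      rintro (a | a | a) b h
      · obtain ⟨d, h1, rfl⟩ := CE_l.1 h
        rw [ψK_e12]
        exact .single (CE_l.2 ⟨_, (I.i1 (.inl ()) _).2 ⟨d, rfl, h1⟩, rfl⟩)
      · rcases CE_m.1 h with ⟨d, h1, rfl⟩ | ⟨h1, r, h2, rfl⟩
        · rw [ψK_e12]
          exact .single (CE_m.2 (.inl ⟨_, (I.i1 (.inr a) _).2 ⟨d, rfl, h1⟩, rfl⟩))
        · cases hr : ρ r
          · rw [tg_f hr]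
            exact .single (CE_m.2 (.inr ⟨h1, _, .fb h2 h1 hr, (tg_f (by exact hr)).symm⟩))
          · rw [tg_t hr]
            exact TransGen.head (CE_m.2 (.inr ⟨h1, _, .ff h2 h1 hr, (tg_f (by simp [Sρ, hr])).symm⟩))
              (A1 r hr)
      · obtain ⟨h1, r, h2, rfl⟩ := CE_r.1 h
        have h1' : Sρ ρ (.u v a) = true := by simp [Sρ, h1]
        refine (A2 a h1).trans ?_
        cases hr : ρ r
        · rw [tg_f hr]
          exact .single (CE_m.2 (.inr ⟨h1', _, .bb h2 h1 hr, (tg_f (by exact hr)).symm⟩))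
        · rw [tg_t hr]
          exact TransGen.head (CE_m.2 (.inr ⟨h1', _, .bf h2 h1 hr, (tg_f (by simp [Sρ, hr])).symm⟩))
              (A1 r hr)
  · intro q d
    constructor
    · intro h
      have key : ρ q = true ∧ (e13 d : Nd Unit (St V Q) (St V Q)) = .r (.w q) := by
        refine reach (fun n => ρ q = true ∧ n = .r (.w q)) h ?_ ?_
        · intro b h
          obtain ⟨h1, r, h2, rfl⟩ := CE_r.1 h
          have h1' : ρ q = true := by simpa [Sρ] using h1
          change DS ρ D z _ _ at h2
          rcases h2 with _ | _ | ⟨h2, h3, h4⟩ | ⟨h2, h3, h4⟩ | ⟨h3⟩ | _ | _ | _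
          · simp [h1'] at h3
          · simp [h1'] at h3
          · exact ⟨h1', tg_t h1'⟩
        · rintro _ c ⟨h0, rfl⟩ h
          obtain ⟨h1, r, h2, rfl⟩ := CE_r.1 h
          exact absurd (h0.symm.trans h1) (by simp)
      refine ⟨key.1, ?_⟩
      have := key.2
      rcases d with d | d <;> cases this
      rfl
    · rintro ⟨h, rfl⟩
      refine .single (CE_r.2 ⟨by simp [Sρ, h], _, .uw h, (tg_t ?_).symm⟩)
      exact h
  · intro q d
    constructor
    · intro h
      have key : ρ q = false ∧ (e13 d : Nd Unit (St V Q) (St V Q)) = .r (.u z q) := by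
        refine reach (fun n => ρ q = false ∧ n = .r (.u z q)) h ?_ ?_
        · intro b h
          obtain ⟨h1, r, h2, rfl⟩ := CE_r.1 h
          change ρ q = false at h1
          change DS ρ D z _ _ at h2
          rcases h2 with _ | _ | _ | _ | _ | ⟨h3⟩ | ⟨h3⟩ | _
          · simp [h1] at h3
          · exact ⟨h3, tg_t (by simp [Sρ, h3])⟩
        · rintro _ c ⟨h0, rfl⟩ h
          obtain ⟨h1, r, h2, rfl⟩ := CE_r.1 h
          simp [Sρ, h0] at h1
      refine ⟨key.1, ?_⟩
      have := key.2
      rcases d with d | d <;> cases this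
      rfl
    · rintro ⟨h, rfl⟩
      refine .single (CE_r.2 ⟨h, _, .wu h, (tg_t ?_).symm⟩)
      simp [Sρ, h]

theorem tprof_irr {A : Type} (M : TwoWayAutomaton Q A) (t : List (Tape A)) (s : Unit ⊕ Q) :
    ¬ tprof M t s s := by
  intro h
  obtain ⟨h1, h2, -⟩ := (tprof_iff M t s s).1 h
  rcases s with s | s
  · exact h2
  · exact absurd (Eq.trans (Eq.symm h1) h2) (by simp)

theorem ffM_inv {A B : Type} (M : TwoWayAutomaton Q B) (u : A → Option V) (o : V → A → B) (v0 : V)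
    (w : List A) :
    INV M.ρ (w.foldl (fun v a => (u a).getD v) v0)
      (tprof (ffM M u o v0) (Tape.lend :: w.map .sym))
      (tprof M (Tape.lend :: (smap (fun v a => (u a).getD v) o v0 w).map .sym)) := by
  induction w using List.reverseRecOn with
  | nil =>
    exact INV_base (fun s => tprof_irr (ffM M u o v0) [Tape.lend] s)
  | append_singleton w a ih =>
    rw [List.foldl_append, smap_append, List.map_append, List.map_append]
    simp only [List.foldl_cons, List.foldl_nil, List.map_cons, List.map_nil, smap, ← List.cons_append]
    rw [tprof_snoc, tprof_snoc]
    have hirr := fun s => tprof_irr (ffM M u o v0) ((Tape.lend :: w.map .sym) ++ [.sym a]) s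
    rw [tprof_snoc] at hirr
    revert hirr
    generalize List.foldl (fun v a => (u a).getD v) v0 w = v at *
    change (∀ s, ¬ comp _ (prof (Sρ M.ρ) (ffδ M u o v0 (.sym a))) s s) →
      INV _ _ (comp _ (prof (Sρ M.ρ) (ffδ M u o v0 (.sym a)))) _
    simp only [ffδ]
    cases hu : u a with
    | none => exact INV_keep (D := fun v => M.δ (.sym (o v a))) ih
    | some x => exact INV_set (D := fun v => M.δ (.sym (o v a))) ih

theorem ffM_lang {A B : Type} (M : TwoWayAutomaton Q B) (u : A → Option V) (o : V → A → B) (v0 : V) :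
    (ffM M u o v0).Language = {w | smap (fun v a => (u a).getD v) o v0 w ∈ M.Language} := by
  ext w
  change (ffM M u o v0).Accepts w ↔ M.Accepts _
  rw [accepts_iff, accepts_iff]
  have I := ffM_inv M u o v0 w
  have hirr := fun s => tprof_irr (ffM M u o v0) ((Tape.lend :: w.map .sym) ++ [.rend]) s
  rw [tprof_snoc] at hirr
  have J := (INV_keep (D := fun _ => M.δ .rend) I hirr).i1
  have e1 := tprof_snoc M (Tape.lend :: (smap (fun v a => (u a).getD v) o v0 w).map .sym) .rend
  have e2 := tprof_snoc (ffM M u o v0) (Tape.lend :: w.map .sym) .rend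
  have J' := J (.inl ())
  constructor
  · rintro ⟨_, ⟨v, q, hq, rfl⟩, h⟩
    change tprof (ffM M u o v0) (Tape.lend :: w.map .sym ++ [.rend]) _ _ at h
    rw [e2] at h
    obtain ⟨d', h1, h2⟩ := (J' _).1 h
    rcases d' with d' | d'
    · cases h1
    · cases h1
      exact ⟨q, hq, by rw [← e1] at h2; exact h2⟩
  · rintro ⟨q, hq, h⟩
    refine ⟨_, ⟨w.foldl (fun v a => (u a).getD v) v0, q, hq, rfl⟩, ?_⟩
    have h' : tprof M (Tape.lend :: (smap (fun v a => (u a).getD v) o v0 w).map .sym ++ [.rend])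
      (.inl ()) (.inr q) := h
    rw [e1] at h'
    have := (J' (.inr (.s _ q))).2 ⟨.inr q, rfl, h'⟩
    change tprof (ffM M u o v0) (Tape.lend :: w.map .sym ++ [.rend]) _ _
    rw [e2]
    exact this

end

section
variable {A : Type}

inductive L3 where
  | s : L3
  | b : L3
  | y : L3

instance : Finite L3 := by
  let F : Option (Option Unit) → L3
    | none => .s
    | some none => .b
    | some (some _) => .y
  apply Finite.of_surjective F
  rintro (_ | _ | _)
  · exact ⟨none, rfl⟩
  · exact ⟨some none, rfl⟩
  · exact ⟨some (some ()), rfl⟩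

inductive LD (R : Option A → Prop) : Tape A → L3 → L3 → Prop
  | s0 : LD R .lend .s .s
  | s1 {a} : LD R (.sym a) .s .s
  | sb : LD R .rend .s .b
  | by0 : R none → LD R .lend .b .y
  | by1 {a} : R (some a) → LD R (.sym a) .b .y
  | yy : LD R .rend .y .y

def ρ3 : L3 → Bool
  | .s => true
  | .b => false
  | .y => true

def h3 : L3 → ℤ
  | .s => 0
  | .b => 1
  | .y => 2

def lastM (R : Option A → Prop) : TwoWayAutomaton L3 A where
  ρ := ρ3
  init := .s
  init_fwd := rfl
  final := {p | p = .y}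
  δ a := {p | LD R a p.1 p.2}

theorem lastM_rev (R : Option A → Prop) : (lastM R).Reversible := by
  intro a
  constructor
  · intro p r r' h1 h2
    change LD R _ _ _ at h1
    change LD R _ _ _ at h2
    cases h1 <;> cases h2 <;> rfl
  · intro p r r' h1 h2
    change LD R _ _ _ at h1
    change LD R _ _ _ at h2
    cases h1 <;> cases h2 <;> rfl

theorem lastM_planar (R : Option A → Prop) : (lastM R).Planar := by
  refine planar_intro h3 ?_ ?_ ?_
  · rintro (_ | _ | _) <;> simp [h3]
  · rintro (_ | _ | _) (_ | _ | _) h <;> simp [h3] at h <;> rfl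
  · intro a q r q' r' h1 h2
    change LD R _ _ _ at h1
    change LD R _ _ _ at h2
    cases h1 <;> cases h2 <;> simp [Xing, ps, pt, h3, lastM, ρ3]

theorem lastM_lang (R : Option A → Prop) : (lastM R).Language = {w | R w.getLast?} := by
  ext w
  change (lastM R).Accepts w ↔ R w.getLast?
  constructor
  · rintro ⟨qf, hqf, h⟩
    have key : ∀ c, ReflTransGen (lastM R).Step ([], .s, tapeOf w) c →
        c.2.1 = .s ∨ (c.1 = Tape.lend :: w.map .sym ∧ c.2.1 = .b) ∨ (R w.getLast? ∧ c.2.1 = .y) := by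
      intro c h
      induction h with
      | refl => exact .inl rfl
      | tail h1 h2 ih =>
        have ht := run_tape (lastM R) h1
        obtain ⟨a, u, v, q, r, hd, hs⟩ := h2
        change LD R _ _ _ at hd
        rcases hd with _ | _ | _ | hR | hR | _
        · left
          rcases hs with ⟨e1, e2, rfl, rfl⟩ | ⟨e1, e2, rfl, rfl⟩ | ⟨e1, e2, rfl, rfl⟩ |
            ⟨e1, e2, rfl, rfl⟩ <;> rfl
        · left
          rcases hs with ⟨e1, e2, rfl, rfl⟩ | ⟨e1, e2, rfl, rfl⟩ | ⟨e1, e2, rfl, rfl⟩ |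
            ⟨e1, e2, rfl, rfl⟩ <;> rfl
        · right; left
          rcases hs with ⟨e1, e2, rfl, rfl⟩ | ⟨e1, e2, rfl, rfl⟩ | ⟨e1, e2, rfl, rfl⟩ |
            ⟨e1, e2, rfl, rfl⟩
          · cases e2
          · refine ⟨?_, rfl⟩
            change u ++ Tape.rend :: v = Tape.lend :: w.map .sym ++ [.rend] at ht
            rcases List.eq_nil_or_concat v with rfl | ⟨v', z, rfl⟩
            · exact (List.append_inj' ht rfl).1
            · exfalso
              rw [List.concat_eq_append, ← List.cons_append, ← List.append_assoc] at ht
              have := (List.append_inj' ht rfl).1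
              have hm : Tape.rend ∈ Tape.lend :: w.map Tape.sym := by rw [← this]; simp
              simp at hm
          · cases e1
          · cases e1
        all_goals
          right; right
          rcases hs with ⟨e1, e2, rfl, rfl⟩ | ⟨e1, e2, rfl, rfl⟩ | ⟨e1, e2, rfl, rfl⟩ |
            ⟨e1, e2, rfl, rfl⟩ <;> try cases e1
          all_goals try cases e2
        · rcases ih with ih | ⟨ih, -⟩ | ⟨-, ih⟩
          · cases ih
          · refine ⟨?_, rfl⟩
            change u ++ [_] = _ at ih
            rcases List.eq_nil_or_concat w with rfl | ⟨v', z, rfl⟩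
            · exact hR
            · exfalso
              rw [List.concat_eq_append, List.map_append, ← List.cons_append] at ih
              have := (List.append_inj' ih rfl).2
              simp at this
          · cases ih
        · rcases ih with ih | ⟨ih, -⟩ | ⟨-, ih⟩
          · cases ih
          · refine ⟨?_, rfl⟩
            change u ++ [_] = _ at ih
            rcases List.eq_nil_or_concat w with rfl | ⟨v', z, rfl⟩
            · exfalso
              have := (List.append_inj' (s₁ := u) (s₂ := []) ih rfl).2
              simp at this
            · rw [List.concat_eq_append, List.map_append, ← List.cons_append] at ih
              have := (List.append_inj' ih rfl).2
              simp at this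
              subst this
              simpa using hR
          · cases ih
        · rcases ih with ih | ⟨-, ih⟩ | ih
          · cases ih
          · cases ih
          · exact ih
    change qf = .y at hqf
    subst hqf
    rcases key _ h with h | ⟨-, h⟩ | h
    · cases h
    · cases h
    · exact h.1
  · intro hR
    have h1 : ∀ (w : List A) z, ReflTransGen (lastM R).Step ([], .s, Tape.lend :: w.map .sym ++ z)
        (Tape.lend :: w.map .sym, .s, z) := by
      intro w
      induction w using List.reverseRecOn with
      | nil =>
        intro z
        exact .single ⟨.lend, [], z, .s, .s, .s0, .inl ⟨rfl, rfl, rfl, rfl⟩⟩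
      | append_singleton w a ih =>
        intro z
        have := ih (.sym a :: z)
        rw [List.map_append]
        simp only [List.map_cons, List.map_nil]
        have e : (Tape.lend :: (w.map Tape.sym ++ [.sym a]) ++ z) =
          Tape.lend :: w.map .sym ++ (.sym a :: z) := by simp
        rw [e]
        exact this.tail ⟨.sym a, _, z, .s, .s, .s1, .inl ⟨rfl, rfl, rfl, rfl⟩⟩
    have h2 := h1 w [.rend]
    have h3 : (lastM R).Step (Tape.lend :: w.map .sym, .s, [.rend])
      (Tape.lend :: w.map .sym, .b, [.rend]) :=
      ⟨.rend, _, [], .s, .b, .sb, .inr (.inl ⟨rfl, rfl, rfl, rfl⟩)⟩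
    have h4 : (lastM R).Step (Tape.lend :: w.map .sym, .b, [.rend])
      (Tape.lend :: w.map .sym, .y, [.rend]) := by
      rcases List.eq_nil_or_concat w with rfl | ⟨v', z, rfl⟩
      · exact ⟨.lend, [], _, .b, .y, .by0 hR, .inr (.inr (.inr ⟨rfl, rfl, rfl, rfl⟩))⟩
      · rw [List.concat_eq_append] at hR ⊢
        have hR' : R (some z) := by simpa using hR
        rw [List.map_append]
        exact ⟨.sym z, Tape.lend :: v'.map .sym, _, .b, .y, .by1 hR',
          .inr (.inr (.inr ⟨rfl, rfl, rfl, rfl⟩))⟩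
    have h5 : (lastM R).Step (Tape.lend :: w.map .sym, .y, [.rend])
      (tapeOf w, .y, []) := ⟨.rend, _, [], .y, .y, .yy, .inl ⟨rfl, rfl, rfl, rfl⟩⟩
    exact ⟨.y, rfl, ((h2.tail h3).tail h4).tail h5⟩

/-- Languages of planar reversible two-way automata. -/
def PR (A : Type) (L : Set (List A)) : Prop :=
  ∃ (Q : Type) (_ : Finite Q) (M : TwoWayAutomaton Q A), M.Planar ∧ M.Reversible ∧ M.Language = L

theorem PR_class : LangClass PR where
  ff A B V _ _ _ u o v L := by
    rintro ⟨Q, _, M, h1, h2, rfl⟩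
    exact ⟨St V Q, inferInstance, ffM M u o v, ffM_planar u o v h1, ffM_rev u o v h2,
      ffM_lang M u o v⟩
  last A _ R := ⟨L3, inferInstance, lastM R, lastM_planar R, lastM_rev R, lastM_lang R⟩

theorem step_map {Q Q' : Type} {M : TwoWayAutomaton Q A} {M' : TwoWayAutomaton Q' A} (f : Q → Q')
    (hρ : ∀ q, M'.ρ (f q) = M.ρ q) (hδ : ∀ a q r, (q, r) ∈ M.δ a → (f q, f r) ∈ M'.δ a)
    (c c' : Config Q A) (h : M.Step c c') :
    M'.Step (c.1, f c.2.1, c.2.2) (c'.1, f c'.2.1, c'.2.2) := by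
  obtain ⟨a, u, v, q, r, hd, h⟩ := h
  refine ⟨a, u, v, f q, f r, hδ _ _ _ hd, ?_⟩
  rw [hρ, hρ]
  rcases h with ⟨e1, e2, rfl, rfl⟩ | ⟨e1, e2, rfl, rfl⟩ | ⟨e1, e2, rfl, rfl⟩ |
            ⟨e1, e2, rfl, rfl⟩ <;> simp [e1, e2]

theorem acc_map {Q Q' : Type} {M : TwoWayAutomaton Q A} {M' : TwoWayAutomaton Q' A} (f : Q → Q')
    (hρ : ∀ q, M'.ρ (f q) = M.ρ q) (hδ : ∀ a q r, (q, r) ∈ M.δ a → (f q, f r) ∈ M'.δ a)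
    (hi : f M.init = M'.init) (hf : ∀ q ∈ M.final, f q ∈ M'.final) (w : List A)
    (h : M.Accepts w) : M'.Accepts w := by
  obtain ⟨qf, h1, h2⟩ := h
  refine ⟨f qf, hf _ h1, ?_⟩
  rw [← hi]
  exact ReflTransGen.lift (fun c : Config Q A => ((c.1, f c.2.1, c.2.2) : Config Q' A))
    (step_map f hρ hδ) _ _ h2

theorem PR_fin {L : Set (List A)} (h : PR A L) :
    ∃ (n : ℕ) (M : TwoWayAutomaton (Fin n) A), M.Planar ∧ M.Reversible ∧ M.Language = L := by
  obtain ⟨Q, _, M, ⟨lt, hlt, hp⟩, hr, rfl⟩ := h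
  obtain ⟨n, ⟨e⟩⟩ := Finite.exists_equiv_fin Q
  let M' : TwoWayAutomaton (Fin n) A :=
    { ρ := fun i => M.ρ (e.symm i), init := e M.init, init_fwd := by simpa using M.init_fwd,
      final := {i | e.symm i ∈ M.final}, δ := fun a => {p | (e.symm p.1, e.symm p.2) ∈ M.δ a} }
  refine ⟨n, M', ?_, ?_, ?_⟩
  · obtain ⟨K, h, h0, hi, hl⟩ := exists_rank lt hlt
    refine planar_intro (fun i => h (e.symm i)) (fun q => (h0 _).1)
      (hi.comp e.symm.injective) ?_
    intro a q r q' r' h1 h2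
    exact NCf_of_planar (fun q => (h0 q).1) hl (hp a) _ _ _ _ h1 h2
  · intro a
    exact ⟨fun q r r' h1 h2 => e.symm.injective ((hr a).1 _ _ _ h1 h2),
      fun q r r' h1 h2 => e.symm.injective ((hr a).2 _ _ _ h1 h2)⟩
  · ext w
    constructor
    · exact acc_map (M := M') e.symm (fun _ => rfl) (fun _ _ _ h => h) (by simp [M']) (fun _ h => h) w
    · exact acc_map (M' := M') e (fun q => by simp [M'])
        (fun a q r h => by
          change (e.symm (e q), e.symm (e r)) ∈ M.δ a
          simpa using h) rfl
        (fun q h => by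
          change e.symm (e q) ∈ M.final
          simpa using h) w

theorem starFree_PR [Finite A] {L : Set (List A)} (h : StarFree L) : PR A L := by
  obtain ⟨M, _, _, hM, g, R, rfl⟩ := StarFree.rec' h
  exact class_of_monoid PR_class hM g R

end

/-- For a language `L ⊆ Σ*` over a finite alphabet, the following
are equivalent: `L` is star-free; `L` is recognized by some planar
deterministic 2DFA; `L` is recognized by some planar reversible 2DFA. -/
theorem starfree_iff_planar_two_way {A : Type} [Fintype A] (L : Set (List A)) :
    (StarFree L ↔
      ∃ (n : ℕ) (M : TwoWayAutomaton (Fin n) A),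
        M.Planar ∧ M.Deterministic ∧ M.Language = L) ∧
    (StarFree L ↔
      ∃ (n : ℕ) (M : TwoWayAutomaton (Fin n) A),
        M.Planar ∧ M.Reversible ∧ M.Language = L) := by
  refine ⟨⟨fun h => ?_, ?_⟩, ⟨fun h => PR_fin (starFree_PR h), ?_⟩⟩
  · obtain ⟨n, M, h1, h2, h3⟩ := PR_fin (starFree_PR h)
    exact ⟨n, M, h1, fun a => (h2 a).1, h3⟩
  · rintro ⟨n, M, h1, h2, rfl⟩
    exact starFree_of_planar M h1 h2
  · rintro ⟨n, M, h1, h2, rfl⟩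
    exact starFree_of_planar M h1 (fun a => (h2 a).1)

end Planar2DFT
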